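/- arXiv:1811.08387 — 4 statements merged into one kernel-verified Lean document; each statement's English description precedes it below -/
import Mathlib

section
/- Let Y be a real Banach space and n a positive integer. If Y has the approximate hyperplane sum property for ℓ∞ⁿ with function γ : (0,1) → (0,1), then the pair (ℓ∞ⁿ, Y) has the Bishop–Phelps–Bollobás property for operators with the function η(ε) = γ(ε/(n+1))². -/
open scoped BigOperators

noncomputable section

def vvec (n : ℕ) (i : Fin n) : Fin n → ℝ :=
  fun j => if 0 < (j : ℕ) ∧ (j : ℕ) ≤ (i : ℕ) then -1 else 1

def MSet (Y : Type*) [NormedAddCommGroup Y] [NormedSpace ℝ Y] (n : ℕ) :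
    Set (Fin n → Y) :=
  {y | ∀ k : ℕ, Odd k → k ≤ n → ∀ c : Fin k → Fin n, StrictMono c →
    ‖∑ j : Fin k, ((-1 : ℝ) ^ (j : ℕ)) • y (c j)‖ ≤ 1}

def AHSpWith (Y : Type*) [NormedAddCommGroup Y] [NormedSpace ℝ Y] (n : ℕ)
    (γ : ℝ → ℝ) : Prop :=
  ∀ ε : ℝ, 0 < ε → ε < 1 →
    (0 < γ ε ∧ γ ε < ε) ∧
    ∀ y ∈ MSet Y n, ∀ A : Finset (Fin n), A.Nonempty →
      ∀ f : Y →L[ℝ] ℝ, ‖f‖ = 1 → (∀ i ∈ A, 1 - γ ε < f (y i)) →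
        ∃ z ∈ MSet Y n, (∀ i, ‖z i - y i‖ < ε) ∧ ‖∑ i ∈ A, z i‖ = (A.card : ℝ)

def AHSp (Y : Type*) [NormedAddCommGroup Y] [NormedSpace ℝ Y] (n : ℕ) : Prop :=
  ∀ ε : ℝ, 0 < ε → ε < 1 → ∃ γ : ℝ, 0 < γ ∧ γ < ε ∧
    ∀ y ∈ MSet Y n, ∀ A : Finset (Fin n), A.Nonempty →
      ∀ f : Y →L[ℝ] ℝ, ‖f‖ = 1 → (∀ i ∈ A, 1 - γ < f (y i)) →
        ∃ z ∈ MSet Y n, (∀ i, ‖z i - y i‖ < ε) ∧ ‖∑ i ∈ A, z i‖ = (A.card : ℝ)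

def BPBpWith (X Y : Type*) [NormedAddCommGroup X] [NormedSpace ℝ X]
    [NormedAddCommGroup Y] [NormedSpace ℝ Y] (η : ℝ → ℝ) : Prop :=
  ∀ ε : ℝ, 0 < ε → ε < 1 →
    (0 < η ε ∧ η ε < ε) ∧
    ∀ T : X →L[ℝ] Y, ‖T‖ = 1 → ∀ x₀ : X, ‖x₀‖ = 1 → 1 - η ε < ‖T x₀‖ →
      ∃ S : X →L[ℝ] Y, ‖S‖ = 1 ∧ ∃ u₀ : X, ‖u₀‖ = 1 ∧
        ‖S u₀‖ = 1 ∧ ‖u₀ - x₀‖ < ε ∧ ‖S - T‖ < ε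

def IsOneNorming {Y : Type*} [NormedAddCommGroup Y] [NormedSpace ℝ Y]
    (B : Set (Y →L[ℝ] ℝ)) : Prop :=
  (∀ f ∈ B, ‖f‖ = 1) ∧ ∀ y : Y, ‖y‖ = sSup ((fun f : Y →L[ℝ] ℝ => |f y|) '' B)

def tauMap (Y : Type*) [Neg Y] (n : ℕ) (y : Fin n → Y) : Fin n → Y :=
  fun i => if h : (i : ℕ) + 1 < n then y ⟨(i : ℕ) + 1, h⟩ else -y ⟨0, i.pos⟩

def ustar (x : lp (fun _ : ℕ => ℝ) 1) : ℝ := ∑' k, x k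

/-- The sign vector equal to `-1` on the coordinates `p ≤ i` and to `1` on the others. -/
def stepVec (n : ℕ) (i : Fin n) : Fin n → ℝ :=
  fun p => if p ≤ i then -1 else 1

/-- The extension of `x : Fin n → ℝ` to `ℕ` by the constant value `-x 0`. -/
def negExt {n : ℕ} [NeZero n] (x : Fin n → ℝ) (k : ℕ) : ℝ :=
  if h : k < n then x ⟨k, h⟩ else -x 0

/-- The coordinate functionals of the basis `stepVec n` of `Fin n → ℝ`. -/
def stepCoord {n : ℕ} [NeZero n] (i : Fin n) : (Fin n → ℝ) →L[ℝ] ℝ :=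
  LinearMap.toContinuousLinearMap
    { toFun := fun x => (negExt x (i + 1) - negExt x i) / 2
      map_add' := fun x y => by
        simp only [negExt]
        split_ifs <;> simp only [Pi.add_apply] <;> ring
      map_smul' := fun c x => by
        simp only [negExt]
        split_ifs <;> simp only [Pi.smul_apply, smul_eq_mul, RingHom.id_apply] <;> ring }

section StepVec

variable {n : ℕ} [NeZero n]

lemma stepCoord_apply (i : Fin n) (x : Fin n → ℝ) :
    stepCoord i x = (negExt x (i + 1) - negExt x i) / 2 := rfl

lemma negExt_coe (x : Fin n → ℝ) (i : Fin n) : negExt x i = x i := by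
  simp [negExt]

lemma negExt_zero (x : Fin n → ℝ) : negExt x 0 = x 0 := by
  simp [negExt, NeZero.pos n]

lemma negExt_self (x : Fin n → ℝ) : negExt x n = -x 0 := by
  simp [negExt]

lemma abs_negExt_le (x : Fin n → ℝ) (k : ℕ) : |negExt x k| ≤ ‖x‖ := by
  unfold negExt
  split_ifs with h
  · exact norm_le_pi_norm x ⟨k, h⟩
  · rw [abs_neg]
    exact norm_le_pi_norm x 0

lemma abs_stepCoord_le (i : Fin n) (x : Fin n → ℝ) : |stepCoord i x| ≤ ‖x‖ := by
  have h₁ := abs_le.1 (abs_negExt_le x (i + 1))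
  have h₂ := abs_le.1 (abs_negExt_le x i)
  rw [stepCoord_apply, abs_le]
  constructor <;> linarith

lemma sum_stepCoord_eq_neg (x : Fin n → ℝ) : ∑ i, stepCoord i x = -x 0 := by
  simp only [stepCoord_apply]
  rw [Fin.sum_univ_eq_sum_range (fun i => (negExt x (i + 1) - negExt x i) / 2) n,
    ← Finset.sum_div, Finset.sum_range_sub, negExt_self, negExt_zero]
  ring

lemma sum_range_half_sub_mul_step (e : ℕ → ℝ) (p n : ℕ) :
    ∑ i ∈ Finset.range n, (e (i + 1) - e i) / 2 * (if p ≤ i then -1 else 1) =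
      if n ≤ p then (e n - e 0) / 2 else e p - (e n + e 0) / 2 := by
  induction n with
  | zero => simp
  | succ n ih =>
    rw [Finset.sum_range_succ, ih]
    rcases lt_trichotomy n p with h | rfl | h
    · rw [if_pos h.le, if_neg h.not_ge, if_pos (Nat.succ_le_of_lt h)]; ring
    · simp; ring
    · rw [if_neg h.not_ge, if_pos h.le, if_neg (by omega)]; ring

lemma sum_stepCoord_smul_stepVec (x : Fin n → ℝ) :
    ∑ i, stepCoord i x • stepVec n i = x := by
  ext p
  simp only [Finset.sum_apply, Pi.smul_apply, smul_eq_mul, stepCoord_apply, stepVec,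
    Fin.le_def]
  rw [Fin.sum_univ_eq_sum_range
    (fun i => (negExt x (i + 1) - negExt x i) / 2 * (if (p : ℕ) ≤ i then -1 else 1)) n,
    sum_range_half_sub_mul_step, if_neg p.2.not_ge, negExt_self, negExt_zero, negExt_coe]
  ring

lemma negExt_stepVec (i : Fin n) (k : ℕ) :
    negExt (stepVec n i) k = if k ≤ i then -1 else 1 := by
  have := i.2
  unfold negExt
  split_ifs with h₁ h₂ h₂
  · simp [stepVec, Fin.le_def, h₂]
  · simp [stepVec, Fin.le_def, h₂]
  · omega
  · simp [stepVec]

lemma stepCoord_stepVec (i j : Fin n) :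
    stepCoord j (stepVec n i) = if j = i then 1 else 0 := by
  rw [stepCoord_apply, negExt_stepVec, negExt_stepVec]
  simp only [Fin.ext_iff]
  split_ifs <;> first | omega | norm_num

lemma stepCoord_nonneg {x : Fin n → ℝ} (hx : Monotone x) (hx₁ : ∀ i, x i ≤ -x 0) (i : Fin n) :
    0 ≤ stepCoord i x := by
  rw [stepCoord_apply, negExt_coe]
  unfold negExt
  split_ifs with h
  · have := hx (show i ≤ ⟨i + 1, h⟩ from Nat.le_succ _)
    linarith
  · linarith [hx₁ i]

end StepVec

lemma alternating_sum_mem_Icc_of_antitone (m : ℕ) (g : Fin (2 * m + 1) → ℝ) (hg : Antitone g) :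
    ∑ j : Fin (2 * m + 1), (-1 : ℝ) ^ (j : ℕ) * g j ∈ Set.Icc (g (Fin.last _)) (g 0) := by
  induction m with
  | zero => simp
  | succ m ih =>
    have h := ih (fun j => g j.castSucc.castSucc)
      (fun a b hab => hg (show a.castSucc.castSucc ≤ b.castSucc.castSucc from hab))
    have h₁ : g (Fin.last (2 * m + 1)).castSucc ≤ g (Fin.last (2 * m)).castSucc.castSucc :=
      hg (by simp [Fin.le_def])
    have h₂ : g (Fin.last (2 * m + 2)) ≤ g (Fin.last (2 * m + 1)).castSucc :=
      hg (by simp [Fin.le_def])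
    change ∑ j : Fin (2 * m + 1 + 1 + 1), (-1 : ℝ) ^ (j : ℕ) * g j ∈ _
    rw [Fin.sum_univ_castSucc, Fin.sum_univ_castSucc]
    simp only [Fin.val_castSucc, Fin.val_last, Set.mem_Icc] at h ⊢
    have h₃ : (-1 : ℝ) ^ (2 * m + 1) = -1 := Odd.neg_one_pow ⟨m, rfl⟩
    have h₄ : (-1 : ℝ) ^ (2 * m + 1 + 1) = 1 := Even.neg_one_pow ⟨m + 1, by ring⟩
    rw [h₃, h₄]
    have h₅ : g (Fin.castSucc (Fin.castSucc (0 : Fin (2 * m + 1)))) = g 0 := rfl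
    have h₆ : g (Fin.last (2 * m + 1 + 1)) = g (Fin.last (2 * (m + 1))) := rfl
    rw [h₅] at h
    constructor
    · linarith [h.1]
    · linarith [h.2]

lemma norm_alternating_sum_stepVec_le {n k : ℕ} (hk : Odd k) (c : Fin k → Fin n)
    (hc : StrictMono c) :
    ‖∑ j : Fin k, ((-1 : ℝ) ^ (j : ℕ)) • stepVec n (c j)‖ ≤ 1 := by
  obtain ⟨m, rfl⟩ := hk
  refine (pi_norm_le_iff_of_nonneg zero_le_one).2 fun p => ?_
  simp only [Finset.sum_apply, Pi.smul_apply, smul_eq_mul, Real.norm_eq_abs]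
  have hbd : ∀ i : Fin n, stepVec n i p ∈ Set.Icc (-1 : ℝ) 1 := fun i => by
    unfold stepVec
    split_ifs <;> norm_num
  have h := alternating_sum_mem_Icc_of_antitone m (fun j => stepVec n (c j) p) fun a b hab => by
    have := hc.monotone hab
    simp only [stepVec]
    split_ifs with h₁ h₂ h₂
    · rfl
    · norm_num
    · exact absurd (h₂.trans this) h₁
    · rfl
  exact abs_le.2 ⟨(hbd _).1.trans h.1, h.2.trans (hbd _).2⟩

section Operators

variable {Y : Type*} [NormedAddCommGroup Y] [NormedSpace ℝ Y]

lemma map_stepVec_mem_MSet {n : ℕ} (T : (Fin n → ℝ) →L[ℝ] Y) (hT : ‖T‖ ≤ 1) :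
    (fun i => T (stepVec n i)) ∈ MSet Y n := by
  intro k hk _ c hc
  have h : ∑ j : Fin k, ((-1 : ℝ) ^ (j : ℕ)) • T (stepVec n (c j)) =
      T (∑ j : Fin k, ((-1 : ℝ) ^ (j : ℕ)) • stepVec n (c j)) := by
    simp only [map_sum, map_smul]
  rw [h]
  exact (T.le_of_opNorm_le_of_le hT (norm_alternating_sum_stepVec_le hk c hc)).trans_eq (by simp)

lemma norm_le_one_of_mem_MSet {n : ℕ} {z : Fin n → Y} (hz : z ∈ MSet Y n) (i : Fin n) :
    ‖z i‖ ≤ 1 := by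
  simpa using hz 1 odd_one i.pos (fun _ => i) (Subsingleton.strictMono _)

/-- The increments of a sequence of signs starting at `-1` alternate in sign. -/
lemma exists_strictMono_sum_half_sub_smul_eq (a : ℕ → ℝ) (ha : ∀ i, a i = -1 ∨ a i = 1)
    (ha₀ : a 0 = -1) (n : ℕ) :
    ∃ k ≤ n, a n = -(-1) ^ k ∧ ∃ c : Fin k → Fin n, StrictMono c ∧ ∀ y : Fin n → Y,
      ∑ i : Fin n, ((a (i + 1) - a i) / 2) • y i =
        ∑ j : Fin k, ((-1 : ℝ) ^ (j : ℕ)) • y (c j) := by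
  induction n with
  | zero => exact ⟨0, le_rfl, by simp [ha₀], id, strictMono_id, by simp⟩
  | succ n ih =>
    obtain ⟨k, hk, hak, c, hc, h⟩ := ih
    by_cases hn : a (n + 1) = a n
    · refine ⟨k, hk.trans n.le_succ, hn.trans hak, fun j => (c j).castSucc,
        fun i j hij => hc hij, fun y => ?_⟩
      rw [Fin.sum_univ_castSucc]
      simpa [hn] using h (fun i => y i.castSucc)
    · have hneg : a (n + 1) = -a n := by
        rcases ha n with h₁ | h₁ <;> rcases ha (n + 1) with h₂ | h₂ <;>
          first | exact absurd (h₂.trans h₁.symm) hn | norm_num [h₁, h₂]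
      refine ⟨k + 1, Nat.succ_le_succ hk, by rw [hneg, hak]; ring,
        Fin.snoc (α := fun _ => Fin (n + 1)) (fun j => (c j).castSucc) (Fin.last n), ?_,
        fun y => ?_⟩
      · intro i j hij
        induction j using Fin.lastCases with
        | last =>
          obtain ⟨i, rfl⟩ := Fin.exists_castSucc_eq.2 hij.ne
          simp [Fin.castSucc_lt_last]
        | cast j =>
          obtain ⟨i, rfl⟩ := Fin.exists_castSucc_eq.2 (hij.trans (Fin.castSucc_lt_last j)).ne
          simpa using hc (by simpa using hij)
      · rw [Fin.sum_univ_castSucc, Fin.sum_univ_castSucc]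
        have h' := h (fun i => y i.castSucc)
        simp only [Fin.val_castSucc, Fin.val_last, Fin.snoc_castSucc, Fin.snoc_last]
        rw [h', hneg, hak]
        congr 2
        ring

lemma opNorm_le_of_forall_sign {ι : Type*} [Fintype ι] (S : (ι → ℝ) →L[ℝ] Y) {C : ℝ}
    (hC : 0 ≤ C) (h : ∀ s : ι → ℝ, (∀ i, s i = -1 ∨ s i = 1) → ‖S s‖ ≤ C) : ‖S‖ ≤ C := by
  have hball : ∀ x : ι → ℝ, ‖x‖ ≤ 1 → ‖S x‖ ≤ C := by
    intro x hx
    have hconv : Convex ℝ {x : ι → ℝ | ‖S x‖ ≤ C} := by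
      have := (convex_closedBall (0 : Y) C).is_linear_preimage S.toLinearMap.isLinear
      simpa [Set.preimage, mem_closedBall_zero_iff] using this
    have hsub : Set.univ.pi (fun _ : ι => ({-1, 1} : Set ℝ)) ⊆ {x : ι → ℝ | ‖S x‖ ≤ C} :=
      fun s hs => h s fun i => by simpa using hs i trivial
    refine convexHull_min hsub hconv ?_
    rw [convexHull_pi]
    intro i _
    rw [convexHull_pair, segment_eq_Icc (by norm_num)]
    exact abs_le.1 ((norm_le_pi_norm x i).trans hx)
  refine S.opNorm_le_of_unit_norm hC fun x hx => hball x hx.le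

/-- The operator on `Fin n → ℝ` that maps `stepVec n i` to `z i`. -/
def stepOperator {n : ℕ} [NeZero n] (z : Fin n → Y) : (Fin n → ℝ) →L[ℝ] Y :=
  ∑ i, (stepCoord i).smulRight (z i)

variable {n : ℕ} [NeZero n]

lemma stepOperator_apply (z : Fin n → Y) (x : Fin n → ℝ) :
    stepOperator z x = ∑ i, stepCoord i x • z i := by
  simp [stepOperator]

lemma stepOperator_stepVec (z : Fin n → Y) (i : Fin n) : stepOperator z (stepVec n i) = z i := by
  simp [stepOperator_apply, stepCoord_stepVec]

lemma norm_stepOperator_le_one {z : Fin n → Y} (hz : z ∈ MSet Y n) : ‖stepOperator z‖ ≤ 1 := by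
  have key : ∀ s : Fin n → ℝ, (∀ i, s i = -1 ∨ s i = 1) → s 0 = -1 →
      ‖stepOperator z s‖ ≤ 1 := by
    intro s hs hs₀
    obtain ⟨k, hk, hak, c, hc, h⟩ := exists_strictMono_sum_half_sub_smul_eq (Y := Y) (negExt s)
      (fun i => by
        unfold negExt
        split_ifs
        · exact hs _
        · simp [hs₀]) (by rw [negExt_zero, hs₀]) n
    rw [stepOperator_apply]
    simp only [stepCoord_apply]
    rw [h z]
    refine hz k ?_ hk c hc
    by_contra hodd
    rw [negExt_self, hs₀, (Nat.not_odd_iff_even.1 hodd).neg_one_pow] at hak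
    norm_num at hak
  refine opNorm_le_of_forall_sign _ zero_le_one fun s hs => ?_
  rcases hs 0 with h₀ | h₀
  · exact key s hs h₀
  · have := key (-s) (fun i => by rcases hs i with h | h <;> simp [h]) (by simp [h₀])
    simpa using this

lemma norm_stepOperator_sub_le (T : (Fin n → ℝ) →L[ℝ] Y) {z : Fin n → Y} {δ : ℝ} (hδ : 0 ≤ δ)
    (hz : ∀ i, ‖z i - T (stepVec n i)‖ ≤ δ) : ‖stepOperator z - T‖ ≤ n * δ := by
  refine ContinuousLinearMap.opNorm_le_bound _ (by positivity) fun x => ?_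
  have h : (stepOperator z - T) x = ∑ i, stepCoord i x • (z i - T (stepVec n i)) := by
    have hTx : T x = ∑ i, stepCoord i x • T (stepVec n i) := by
      conv_lhs => rw [← sum_stepCoord_smul_stepVec x]
      simp only [map_sum, map_smul]
    rw [sub_apply, stepOperator_apply, hTx]
    simp only [smul_sub, Finset.sum_sub_distrib]
  rw [h]
  refine (norm_sum_le_of_le _ (fun i _ => ?_)).trans_eq
    (b := ∑ _i : Fin n, ‖x‖ * δ) (by simp; ring)
  rw [norm_smul]
  exact mul_le_mul (abs_stepCoord_le i x) (hz i) (norm_nonneg _) (norm_nonneg _)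

end Operators

lemma norm_stepVec_le {n : ℕ} (i : Fin n) : ‖stepVec n i‖ ≤ 1 := by
  refine (pi_norm_le_iff_of_nonneg zero_le_one).2 fun p => ?_
  unfold stepVec
  split_ifs <;> simp

/-- If a convex combination of numbers `t i ≤ 1` exceeds `1 - g ^ 2`, then the indices with
`t i ≤ 1 - g` carry weight less than `g`. -/
lemma sum_weight_compl_lt {ι : Type*} [Fintype ι] [DecidableEq ι] {w t : ι → ℝ} {g : ℝ}
    (hg : 0 < g) (hw : ∀ i, 0 ≤ w i) (hw₁ : ∑ i, w i = 1) (ht : ∀ i, t i ≤ 1)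
    (h : 1 - g ^ 2 < ∑ i, w i * t i) {A : Finset ι} (hA : ∀ i ∉ A, t i ≤ 1 - g) :
    ∑ i ∈ Aᶜ, w i < g := by
  have h₁ : ∑ i, w i * t i ≤ ∑ i ∈ A, w i + (1 - g) * ∑ i ∈ Aᶜ, w i := by
    rw [← Finset.sum_add_sum_compl A, Finset.mul_sum]
    refine add_le_add (Finset.sum_le_sum fun i _ => ?_) (Finset.sum_le_sum fun i hi => ?_)
    · nlinarith [hw i, ht i]
    · nlinarith [hw i, hA i (Finset.mem_compl.1 hi)]
  rw [← Finset.sum_add_sum_compl A] at hw₁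
  nlinarith

/-- If vectors of the unit ball have a sum of maximal norm, a single functional norms them all. -/
lemma exists_dual_eq_one_of_norm_sum_eq_card {Y ι : Type*} [NormedAddCommGroup Y]
    [NormedSpace ℝ Y] {A : Finset ι} (hA : A.Nonempty) {z : ι → Y} (hz : ∀ i ∈ A, ‖z i‖ ≤ 1)
    (h : ‖∑ i ∈ A, z i‖ = A.card) : ∃ f : Y →L[ℝ] ℝ, ‖f‖ = 1 ∧ ∀ i ∈ A, f (z i) = 1 := by
  have hne : ‖∑ i ∈ A, z i‖ ≠ 0 := by
    rw [h]
    exact_mod_cast hA.card_pos.ne'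
  obtain ⟨f, hf, hfz⟩ := exists_dual_vector ℝ _ hne
  refine ⟨f, hf, (Finset.sum_eq_sum_iff_of_le (g := fun _ => (1 : ℝ)) fun i hi => ?_).1 ?_⟩
  · exact (le_abs_self _).trans
      ((f.le_of_opNorm_le_of_le hf.le (hz i hi)).trans_eq (one_mul 1))
  · rw [← map_sum, hfz, h]
    simp

lemma exists_approx_of_monotone {Y : Type*} [NormedAddCommGroup Y] [NormedSpace ℝ Y] {n : ℕ}
    [NeZero n] {δ g : ℝ} (hδ : 0 < δ) (hg : 0 < g) (hgδ : g < δ) (hg₁ : g < 1)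
    (h : ∀ y ∈ MSet Y n, ∀ A : Finset (Fin n), A.Nonempty →
      ∀ f : Y →L[ℝ] ℝ, ‖f‖ = 1 → (∀ i ∈ A, 1 - g < f (y i)) →
        ∃ z ∈ MSet Y n, (∀ i, ‖z i - y i‖ < δ) ∧ ‖∑ i ∈ A, z i‖ = (A.card : ℝ))
    (T : (Fin n → ℝ) →L[ℝ] Y) (hT : ‖T‖ = 1) {x : Fin n → ℝ} (hx : ‖x‖ = 1)
    (hmono : Monotone x) (hx₀ : x 0 = -1) (hTx : 1 - g ^ 2 < ‖T x‖) :
    ∃ S : (Fin n → ℝ) →L[ℝ] Y, ‖S‖ = 1 ∧ ∃ u : Fin n → ℝ, ‖u‖ = 1 ∧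
      ‖S u‖ = 1 ∧ ‖u - x‖ < 2 * δ ∧ ‖S - T‖ ≤ n * δ := by
  classical
  have hTx₀ : ‖T x‖ ≠ 0 := by nlinarith
  obtain ⟨f, hf, hfx⟩ := exists_dual_vector ℝ _ hTx₀
  set w : Fin n → ℝ := fun i => stepCoord i x with hw_def
  have hw : ∀ i, 0 ≤ w i := stepCoord_nonneg hmono fun i => by
    rw [hx₀, neg_neg]
    exact (le_abs_self _).trans ((norm_le_pi_norm x i).trans hx.le)
  have hw₁ : ∑ i, w i = 1 := by rw [hw_def, sum_stepCoord_eq_neg, hx₀, neg_neg]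
  have hy := map_stepVec_mem_MSet T hT.le
  have hx_sum : ∑ i, w i • stepVec n i = x := sum_stepCoord_smul_stepVec x
  set A : Finset (Fin n) := {i | 1 - g < f (T (stepVec n i))} with hA_def
  have hcompl : ∑ i ∈ Aᶜ, w i < g := by
    refine sum_weight_compl_lt (t := fun i => f (T (stepVec n i))) hg hw hw₁ (fun i => ?_) ?_
      fun i hi => by simpa [hA_def] using hi
    · exact (le_abs_self _).trans ((f.le_of_opNorm_le_of_le hf.le
        (norm_le_one_of_mem_MSet hy i)).trans_eq (one_mul 1))
    · have : ∑ i, w i * f (T (stepVec n i)) = f (T x) := by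
        rw [← hx_sum]
        simp only [map_sum, map_smul, smul_eq_mul]
      rw [this, hfx]
      exact hTx
  have hsplit : ∑ i ∈ A, w i + ∑ i ∈ Aᶜ, w i = 1 := by rw [Finset.sum_add_sum_compl, hw₁]
  set a := ∑ i ∈ A, w i with ha_def
  have ha : 0 < a := by linarith
  have hAne : A.Nonempty := by
    by_contra hempty
    rw [Finset.not_nonempty_iff_eq_empty.1 hempty, Finset.sum_empty] at ha_def
    exact ha.ne' ha_def
  obtain ⟨z, hz, hzy, hzA⟩ := h _ hy A hAne f hf fun i hi => by simpa [hA_def] using hi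
  obtain ⟨φ, hφ, hφz⟩ := exists_dual_eq_one_of_norm_sum_eq_card hAne
    (fun i _ => norm_le_one_of_mem_MSet hz i) hzA
  have hS := norm_stepOperator_le_one hz
  have hsum_le : ∀ B : Finset (Fin n), ‖∑ i ∈ B, w i • stepVec n i‖ ≤ ∑ i ∈ B, w i := fun B =>
    norm_sum_le_of_le _ fun i _ => by
      rw [norm_smul, Real.norm_of_nonneg (hw i)]
      exact mul_le_of_le_one_right (hw i) (norm_stepVec_le i)
  set v := ∑ i ∈ A, w i • stepVec n i with hv_def
  have hu_le : ‖a⁻¹ • v‖ ≤ 1 := by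
    rw [norm_smul, Real.norm_of_nonneg (by positivity), inv_mul_le_one₀ ha]
    exact hsum_le A
  have hφu : φ (stepOperator z (a⁻¹ • v)) = 1 := by
    rw [map_smul, map_smul, hv_def, map_sum, map_sum, smul_eq_mul]
    have : ∀ i ∈ A, φ (stepOperator z (w i • stepVec n i)) = w i := fun i hi => by
      rw [map_smul, map_smul, stepOperator_stepVec, hφz i hi, smul_eq_mul, mul_one]
    rw [Finset.sum_congr rfl this]
    exact inv_mul_cancel₀ ha.ne'
  have hSu_ge : 1 ≤ ‖stepOperator z (a⁻¹ • v)‖ := by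
    have := φ.le_of_opNorm_le hφ.le (stepOperator z (a⁻¹ • v))
    rwa [hφu, norm_one, one_mul] at this
  have hSu_le := (stepOperator z).le_opNorm (a⁻¹ • v)
  refine ⟨stepOperator z, le_antisymm hS ?_, a⁻¹ • v, le_antisymm hu_le ?_,
    le_antisymm ?_ hSu_ge, ?_, norm_stepOperator_sub_le T hδ.le fun i => (hzy i).le⟩
  · nlinarith [norm_nonneg (stepOperator z)]
  · nlinarith [norm_nonneg (a⁻¹ • v)]
  · nlinarith [norm_nonneg (stepOperator z), norm_nonneg (a⁻¹ • v)]
  · have hsub : a⁻¹ • v - x = (1 - a) • (a⁻¹ • v) - ∑ i ∈ Aᶜ, w i • stepVec n i := by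
      rw [← hx_sum, ← Finset.sum_add_sum_compl A, ← hv_def, sub_smul, one_smul, smul_smul,
        mul_inv_cancel₀ ha.ne', one_smul]
      abel
    have h₁ : ‖(1 - a) • (a⁻¹ • v)‖ ≤ 1 - a := by
      have ha₁ : 0 ≤ 1 - a := by
        have := Finset.sum_nonneg fun i (_ : i ∈ Aᶜ) => hw i
        linarith
      rw [norm_smul, Real.norm_of_nonneg ha₁]
      exact mul_le_of_le_one_right ha₁ hu_le
    rw [hsub]
    linarith [norm_sub_le ((1 - a) • (a⁻¹ • v)) (∑ i ∈ Aᶜ, w i • stepVec n i), hsum_le Aᶜ]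

/-- Up to a sign, a unit vector of `Fin n → ℝ` can be rearranged into a monotone vector whose
least coordinate is `-1`. -/
lemma exists_perm_monotone_of_norm_eq_one {n : ℕ} [NeZero n] {x : Fin n → ℝ} (hx : ‖x‖ = 1) :
    ∃ π : Equiv.Perm (Fin n), (Monotone (x ∘ π) ∧ (x ∘ π) 0 = -1) ∨
      (Monotone ((-x) ∘ π) ∧ ((-x) ∘ π) 0 = -1) := by
  have key : ∀ y : Fin n → ℝ, ‖y‖ = 1 → ∀ p, y p = -1 →
      ∃ π : Equiv.Perm (Fin n), Monotone (y ∘ π) ∧ (y ∘ π) 0 = -1 := by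
    intro y hy p hp
    refine ⟨Tuple.sort y, Tuple.monotone_sort y, le_antisymm ?_ ?_⟩
    · have := Tuple.monotone_sort y (Fin.zero_le ((Tuple.sort y).symm p))
      simpa [hp] using this
    · exact (abs_le.1 ((norm_le_pi_norm y _).trans hy.le)).1
  obtain ⟨p, hmax⟩ := Finite.exists_max fun i => ‖x i‖
  have hp : |x p| = 1 := hx ▸ le_antisymm (norm_le_pi_norm x p)
    ((pi_norm_le_iff_of_nonneg (norm_nonneg _)).2 hmax)
  rcases eq_or_eq_neg_of_abs_eq hp with hp | hp
  · obtain ⟨π, hπ⟩ := key (-x) (by rwa [norm_neg]) p (by simp [hp])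
    exact ⟨π, Or.inr hπ⟩
  · obtain ⟨π, hπ⟩ := key x hx p hp
    exact ⟨π, Or.inl hπ⟩

/-- Precomposition with a permutation, as a linear isometry of the maximum norm. -/
def permIsometry {ι : Type*} [Fintype ι] (π : Equiv.Perm ι) : (ι → ℝ) ≃ₗᵢ[ℝ] (ι → ℝ) where
  toLinearEquiv := LinearEquiv.funCongrLeft ℝ ℝ π
  norm_map' x := by
    refine le_antisymm ?_ ?_ <;> refine (pi_norm_le_iff_of_nonneg (norm_nonneg _)).2 fun i => ?_
    · exact norm_le_pi_norm x (π i)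
    · simpa using norm_le_pi_norm (LinearEquiv.funCongrLeft ℝ ℝ π x) (π.symm i)

/-- if `Y` has the AHSp-ℓ∞ⁿ with function `γ`, then the pair `(ℓ∞ⁿ, Y)` has the
BPBp with the function `η(ε) = γ(ε/(n+1))²`. -/
theorem stmt15 (Y : Type*) [NormedAddCommGroup Y] [NormedSpace ℝ Y] [CompleteSpace Y]
    (n : ℕ) (hn : 0 < n) (γ : ℝ → ℝ)
    (h : AHSpWith Y n γ) :
    BPBpWith (Fin n → ℝ) Y (fun ε => (γ (ε / ((n : ℝ) + 1))) ^ 2) := by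
  have : NeZero n := ⟨hn.ne'⟩
  intro ε hε hε₁
  have hn₁ : (1 : ℝ) ≤ n := by exact_mod_cast hn
  set δ := ε / ((n : ℝ) + 1) with hδ_def
  have hmul : (n + 1) * δ = ε := by
    rw [hδ_def]
    field_simp
  have hδ : 0 < δ := by positivity
  have hδε : 2 * δ ≤ ε := by nlinarith
  obtain ⟨⟨hg, hgδ⟩, hA⟩ := h δ hδ (by linarith)
  beta_reduce
  rw [← hδ_def]
  refine ⟨⟨by positivity, by nlinarith⟩, ?_⟩
  have main : ∀ T : (Fin n → ℝ) →L[ℝ] Y, ‖T‖ = 1 → ∀ x : Fin n → ℝ, ‖x‖ = 1 →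
      ∀ π : Equiv.Perm (Fin n), Monotone (x ∘ π) → (x ∘ π) 0 = -1 → 1 - γ δ ^ 2 < ‖T x‖ →
      ∃ S : (Fin n → ℝ) →L[ℝ] Y, ‖S‖ = 1 ∧ ∃ u : Fin n → ℝ, ‖u‖ = 1 ∧
        ‖S u‖ = 1 ∧ ‖u - x‖ < ε ∧ ‖S - T‖ < ε := by
    intro T hT x hx π hmono hx₀ hTx
    let e : (Fin n → ℝ) ≃ₗᵢ[ℝ] (Fin n → ℝ) := (permIsometry π).symm
    have hex : e (x ∘ π) = x := (permIsometry π).symm_apply_apply x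
    have hnorm : ∀ R : (Fin n → ℝ) →L[ℝ] Y, ∀ e' : (Fin n → ℝ) ≃ₗᵢ[ℝ] (Fin n → ℝ),
        ‖R ∘L (e' : (Fin n → ℝ) →L[ℝ] (Fin n → ℝ))‖ = ‖R‖ :=
      fun R e' => R.opNorm_comp_linearIsometryEquiv e'
    obtain ⟨S, hS, u, hu, hSu, hux, hST⟩ := exists_approx_of_monotone hδ hg hgδ (by linarith) hA
      (T ∘L (e : (Fin n → ℝ) →L[ℝ] (Fin n → ℝ))) ((hnorm T e).trans hT)
      (by rw [← e.norm_map, hex, hx]) hmono hx₀ (by simpa [hex] using hTx)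
    refine ⟨S ∘L (e.symm : (Fin n → ℝ) →L[ℝ] (Fin n → ℝ)), (hnorm S e.symm).trans hS, e u,
      (e.norm_map u).trans hu, by simpa using hSu, ?_, ?_⟩
    · have : e u - x = e (u - x ∘ π) := by rw [map_sub, hex]
      rw [this, e.norm_map]
      linarith
    · have : S ∘L (e.symm : (Fin n → ℝ) →L[ℝ] (Fin n → ℝ)) - T =
          (S - T ∘L (e : (Fin n → ℝ) →L[ℝ] (Fin n → ℝ))) ∘L
            (e.symm : (Fin n → ℝ) →L[ℝ] (Fin n → ℝ)) := by
        ext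
        simp
      rw [this, hnorm]
      linarith
  intro T hT x hx hTx
  obtain ⟨π, ⟨hmono, hx₀⟩ | ⟨hmono, hx₀⟩⟩ := exists_perm_monotone_of_norm_eq_one hx
  · exact main T hT x hx π hmono hx₀ hTx
  · obtain ⟨S, hS, u, hu, hSu, hux, hST⟩ := main T hT (-x) (by rwa [norm_neg]) π hmono hx₀
      (by rwa [map_neg, norm_neg])
    refine ⟨S, hS, -u, by rwa [norm_neg], by rwa [map_neg, norm_neg], ?_, hST⟩
    rwa [← norm_neg, neg_sub, sub_neg_eq_add, add_comm, ← sub_neg_eq_add]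
end
end

section
/- Let r, s be positive real numbers, y ∈ ℓ₁, m a positive integer, and x₁, …, x_m ∈ ℓ₁. Assume that 1 − r ≤ u*(xᵢ + y) and ‖xᵢ + y‖ ≤ 1 + s for all i ≤ m. Then there exists w ∈ ℓ₁ such that w ≥ y (coordinatewise), ‖w − y‖ ≤ m(r + s), and xᵢ + w ≥ 0 (coordinatewise) for all i ≤ m. -/
open scoped BigOperators

noncomputable section

theorem lp_one_summable_abs (z : lp (fun _ : ℕ => ℝ) 1) : Summable fun k => |z k| := by
  have h := (lp.memℓp z).summable (by norm_num)
  simpa using h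

theorem lp_one_norm_eq_tsum_abs (z : lp (fun _ : ℕ => ℝ) 1) : ‖z‖ = ∑' k, |z k| := by
  have h := lp.norm_eq_tsum_rpow (p := 1) (by norm_num) z
  simpa using h

/-- The vector `|z| - z` is positive, dominates `-z`, and has norm `‖z‖ - u*(z)`. -/
theorem exists_nonneg_add_nonneg (z : lp (fun _ : ℕ => ℝ) 1) :
    ∃ v : lp (fun _ : ℕ => ℝ) 1, (∀ k, 0 ≤ v k) ∧ (∀ k, 0 ≤ z k + v k) ∧
      ‖v‖ = ‖z‖ - ustar z := by
  have hz := lp_one_summable_abs z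
  have hnonneg : ∀ k, 0 ≤ |z k| - z k := fun k => sub_nonneg.2 (le_abs_self _)
  have hmem : Memℓp (fun k => |z k| - z k) 1 := by
    refine memℓp_gen ?_
    simpa [abs_of_nonneg (hnonneg _)] using hz.sub hz.of_abs
  refine ⟨⟨_, hmem⟩, hnonneg, fun k => ?_, ?_⟩
  · change 0 ≤ z k + (|z k| - z k)
    simp
  · rw [lp_one_norm_eq_tsum_abs, lp_one_norm_eq_tsum_abs, ustar, ← hz.tsum_sub hz.of_abs]
    exact tsum_congr fun k => abs_of_nonneg (hnonneg k)

/-- Lemma 4.1: given `x₁,…,x_m, y ∈ ℓ₁` with `1 − r ≤ u*(xᵢ + y)` and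
`‖xᵢ + y‖ ≤ 1 + s` for all `i ≤ m`, there is `w ∈ ℓ₁` with `w ≥ y` coordinatewise,
`‖w − y‖ ≤ m(r + s)`, and `xᵢ + w ≥ 0` coordinatewise for all `i ≤ m`. -/
theorem stmt16 (r s : ℝ) (hr : 0 < r) (hs : 0 < s) (y : lp (fun _ : ℕ => ℝ) 1)
    (m : ℕ) (hm : 0 < m) (x : Fin m → lp (fun _ : ℕ => ℝ) 1)
    (h1 : ∀ i, 1 - r ≤ ustar (x i + y))
    (h2 : ∀ i, ‖x i + y‖ ≤ 1 + s) :
    ∃ w : lp (fun _ : ℕ => ℝ) 1, (∀ k, y k ≤ w k) ∧ ‖w - y‖ ≤ (m : ℝ) * (r + s) ∧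
      ∀ i, ∀ k, 0 ≤ x i k + w k := by
  choose v hv hzv hnorm using fun i => exists_nonneg_add_nonneg (x i + y)
  have hsum : ∀ k, (y + ∑ i, v i) k = y k + ∑ i, v i k := fun k => by
    rw [lp.coeFn_add, Pi.add_apply, lp.coeFn_sum]
    exact congrArg (y k + ·) (Finset.sum_apply k Finset.univ fun i => ⇑(v i))
  refine ⟨y + ∑ i, v i, fun k => ?_, ?_, fun i k => ?_⟩
  · rw [hsum]
    exact le_add_of_nonneg_right (Finset.sum_nonneg fun i _ => hv i k)
  · rw [add_sub_cancel_left]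
    refine (norm_sum_le _ _).trans ?_
    have hle : ∀ i ∈ Finset.univ, ‖v i‖ ≤ r + s := fun i _ => by
      linarith [hnorm i, h1 i, h2 i]
    simpa [mul_add] using Finset.sum_le_sum hle
  · have hvi := Finset.single_le_sum (fun j _ => hv j k) (Finset.mem_univ i)
    have hxy := hzv i k
    rw [lp.coeFn_add, Pi.add_apply] at hxy
    rw [hsum]
    linarith
end
end

section
/- For each positive integer n there exists a function ρₙ : (0,1) → (0,1) such that: (1) ρₙ(ε) < ε for all ε ∈ (0,1); (2) for each 0 < ε < 1, each (y₁,…,yₙ) ∈ M_{ℓ₁}ⁿ and each n₀ ≤ n such that u*(yᵢ) > 1 − ρₙ(ε) for all i ≤ n₀, there exists (z₁,…,zₙ) ∈ M_{ℓ₁}ⁿ satisfying: (a) ‖zᵢ − yᵢ‖ < ε for all i ≤ n, and (b) zᵢ ≥ 0 (coordinatewise) and u*(zᵢ) = 1 for all i ≤ n₀. -/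
open scoped BigOperators

noncomputable section

/-- Every vector is a conformal nonnegative combination (no cancellation in any coordinate of its
image under `f`) of finitely many nonzero vectors depending only on the injective map `f`. -/
theorem exists_conformal_generators {ι : Type} {E : Type*} [Fintype ι] [AddCommGroup E]
    [Module ℝ E] (f : E →ₗ[ℝ] ι → ℝ) (hf : Function.Injective f) :
    ∃ (κ : Type) (_ : Fintype κ) (r : κ → E), (∀ j, r j ≠ 0) ∧
      ∀ a, ∃ l : κ → ℝ, (∀ j, 0 ≤ l j) ∧ a = ∑ j, l j • r j ∧
        ∀ i, |f a i| = ∑ j, l j * |f (r j) i| := by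
  classical
  let Elem : E → Prop := fun a =>
    a ≠ 0 ∧ ∀ b, (∀ i, f a i = 0 → f b i = 0) → ∃ c : ℝ, b = c • a
  let zer : E → Set ι := fun a => {i | f a i = 0}
  let κ₀ : Type := {S : Set ι // ∃ a, Elem a ∧ zer a = S}
  let g : κ₀ → E := fun S => S.2.choose
  have hg : ∀ S : κ₀, Elem (g S) ∧ zer (g S) = S.1 := fun S => S.2.choose_spec
  let r : κ₀ × Bool → E := fun p => if p.2 then g p.1 else -g p.1
  have hκ : Fintype (κ₀ × Bool) := Fintype.ofFinite _
  refine ⟨κ₀ × Bool, hκ, r, ?_, ?_⟩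
  · rintro ⟨S, s⟩
    have := (hg S).1.1
    cases s <;> simpa [r] using this
  let D : E → Prop := fun a => ∃ l : κ₀ × Bool → ℝ, (∀ j, 0 ≤ l j) ∧ a = ∑ j, l j • r j ∧
        ∀ i, |f a i| = ∑ j, l j * |f (r j) i|
  change ∀ a, D a
  have D_zero : D 0 := ⟨0, by simp⟩
  have D_single : ∀ (j : κ₀ × Bool) (c : ℝ), 0 ≤ c → D (c • r j) := by
    intro j c hc
    refine ⟨Pi.single j c, ?_, ?_, ?_⟩
    · intro j'
      by_cases h : j' = j
      · subst h; simpa using hc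
      · simp [h]
    · rw [Finset.sum_eq_single j] <;> simp +contextual
    · intro i
      rw [Finset.sum_eq_single j] <;> simp +contextual [abs_mul, abs_of_nonneg hc]
  have D_add : ∀ a b, D a → D b → (∀ i, 0 ≤ f a i * f b i) → D (a + b) := by
    rintro a b ⟨l, hl, ha, hla⟩ ⟨m, hm, hb, hmb⟩ hab
    refine ⟨l + m, fun j => add_nonneg (hl j) (hm j), ?_, ?_⟩
    · simp only [Pi.add_apply, add_smul, Finset.sum_add_distrib]
      rw [← ha, ← hb]
    · intro i
      simp only [Pi.add_apply, add_mul, Finset.sum_add_distrib, map_add]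
      rw [← hla, ← hmb]
      rw [abs_add_eq_add_abs_iff]
      rcases mul_nonneg_iff.1 (hab i) with h | h
      · exact Or.inl h
      · exact Or.inr h
  have D_elem : ∀ a, Elem a → D a := by
    intro a ha
    let S : κ₀ := ⟨zer a, a, ha, rfl⟩
    obtain ⟨c, hc⟩ := (hg S).1.2 a (fun i hi => by
      have : i ∈ zer (g S) := hi
      rw [(hg S).2] at this
      exact this)
    rcases le_total 0 c with h | h
    · have := D_single (S, true) c h
      simpa [r, ← hc] using this
    · have := D_single (S, false) (-c) (neg_nonneg.2 h)
      simpa [r, ← hc] using this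
  let supp : E → Finset ι := fun a => Finset.univ.filter (fun i => f a i ≠ 0)
  have mem_supp : ∀ a i, i ∈ supp a ↔ f a i ≠ 0 := by simp [supp]
  have supp_ne : ∀ a, a ≠ 0 → (supp a).Nonempty := by
    intro a ha
    by_contra h
    apply ha
    apply hf
    rw [map_zero]
    funext i
    by_contra hi
    exact h ⟨i, (mem_supp a i).2 hi⟩
  intro a
  induction hN : (supp a).card using Nat.strong_induction_on generalizing a with
  | _ N ih =>
  subst hN
  have step : ∀ b i, i ∈ supp a → f b i = 0 → (∀ i, f a i = 0 → f b i = 0) → D b := by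
    intro b i hi hb hab
    refine ih _ (Finset.card_lt_card ?_) b rfl
    rw [Finset.ssubset_iff_of_subset]
    · exact ⟨i, hi, by simp [mem_supp, hb]⟩
    · intro i' hi'
      rw [mem_supp] at hi' ⊢
      exact fun h => hi' (hab i' h)
  by_cases ha0 : a = 0
  · rw [ha0]; exact D_zero
  by_cases hE : Elem a
  · exact D_elem a hE
  have hE' : ∃ b, (∀ i, f a i = 0 → f b i = 0) ∧ ∀ c : ℝ, b ≠ c • a := by
    by_contra! h
    exact hE ⟨ha0, h⟩
  obtain ⟨b, hb, hbc⟩ := hE'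
  obtain ⟨i₀, hi₀, hmin⟩ := Finset.exists_min_image (supp a) (fun i => f b i / f a i)
    (supp_ne a ha0)
  set c : ℝ := f b i₀ / f a i₀ with hc
  set b' : E := b - c • a with hb'
  have hb'0 : b' ≠ 0 := fun h => hbc c (sub_eq_zero.1 h)
  have fb' : ∀ i, f b' i = f b i - c * f a i := fun i => by simp [hb']
  have hz : ∀ i, f a i = 0 → f b' i = 0 := fun i hi => by rw [fb', hb i hi, hi]; simp
  have hi₀' : f b' i₀ = 0 := by
    rw [fb', hc, div_mul_cancel₀ _ ((mem_supp a i₀).1 hi₀), sub_self]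
  have hq : ∀ i, f a i ≠ 0 → 0 ≤ f b' i / f a i := by
    intro i hi
    rw [fb', sub_div, mul_div_cancel_right₀ _ hi]
    exact sub_nonneg.2 (hmin i ((mem_supp a i).2 hi))
  obtain ⟨i₁, hi₁, hmin'⟩ := Finset.exists_min_image (supp b') (fun i => f a i / f b' i)
    (supp_ne b' hb'0)
  rw [mem_supp] at hi₁
  have hi₁a : f a i₁ ≠ 0 := fun h => hi₁ (hz i₁ h)
  set t : ℝ := f a i₁ / f b' i₁ with ht
  have ht0 : 0 ≤ t := by
    have := hq i₁ hi₁a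
    rw [ht, ← inv_div]
    exact inv_nonneg.2 this
  have fd : ∀ i, f (a - t • b') i = f a i - t * f b' i := fun i => by simp
  have hadd : a = (a - t • b') + t • b' := by abel
  rw [hadd]
  apply D_add
  · refine step _ i₁ ((mem_supp a i₁).2 hi₁a) ?_ ?_
    · rw [fd, ht, div_mul_cancel₀ _ hi₁, sub_self]
    · intro i hi
      rw [fd, hz i hi, hi]; simp
  · refine step _ i₀ hi₀ ?_ ?_
    · simp [hi₀']
    · intro i hi
      simp [hz i hi]
  · intro i
    rw [fd, map_smul, Pi.smul_apply, smul_eq_mul]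
    by_cases h : f b' i = 0
    · simp [h]
    · have h1 : t ≤ f a i / f b' i := hmin' i ((mem_supp b' i).2 h)
      have h2 : (f a i - t * f b' i) * (t * f b' i)
          = t * (f b' i) ^ 2 * (f a i / f b' i - t) := by
        field_simp
      rw [h2]
      exact mul_nonneg (mul_nonneg ht0 (sq_nonneg _)) (sub_nonneg.2 h1)

/-- On a compact set, points that almost satisfy finitely many inequalities `1 ≤ h i x` lie in any
prescribed neighbourhood `U` of the solutions. -/
theorem IsCompact.eventually_mem_of_almost_ge {X I : Type*} [TopologicalSpace X] [Finite I]
    {K U : Set X} (hK : IsCompact K) (hU : IsOpen U) {h : I → X → ℝ}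
    (hh : ∀ i, Continuous (h i)) (hsol : ∀ x ∈ K, (∀ i, 1 ≤ h i x) → x ∈ U) :
    ∀ᶠ ρ : ℝ in nhds 0, ∀ x ∈ K, (∀ i, 1 - ρ < h i x) → x ∈ U := by
  have hc : IsCompact (K \ U) := hK.diff hU
  have key : ∀ᶠ ρ : ℝ in nhds 0, ∀ x ∈ K \ U, ∃ i, h i x < 1 - ρ := by
    apply hc.eventually_forall_of_forall_eventually
    rintro x ⟨hxK, hxU⟩
    have hi : ∃ i, h i x < 1 := by
      by_contra! hcon
      exact hxU (hsol x hxK hcon)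
    obtain ⟨i, hi⟩ := hi
    have ho : IsOpen {p : ℝ × X | h i p.2 < 1 - p.1} :=
      isOpen_lt ((hh i).comp continuous_snd) (continuous_const.sub continuous_fst)
    have hmem : ((0 : ℝ), x) ∈ {p : ℝ × X | h i p.2 < 1 - p.1} := by simpa using hi
    filter_upwards [ho.mem_nhds hmem] with p hp
    exact ⟨i, hp⟩
  filter_upwards [key] with ρ hρ x hx hxi
  by_contra hxU
  obtain ⟨i, hi⟩ := hρ x ⟨hx, hxU⟩
  exact absurd hi (not_lt.2 (hxi i).le)

theorem summable_abs_lp_one (x : lp (fun _ : ℕ => ℝ) 1) : Summable fun k => |x k| := by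
  simpa using (lp.memℓp x).summable (by norm_num)

theorem norm_lp_one_eq_tsum (x : lp (fun _ : ℕ => ℝ) 1) : ‖x‖ = ∑' k, |x k| := by
  simpa using lp.norm_eq_tsum_rpow (p := 1) (by norm_num) x

theorem hasSum_ustar (x : lp (fun _ : ℕ => ℝ) 1) : HasSum (fun k => x k) (ustar x) :=
  (summable_abs_lp_one x).of_abs.hasSum

theorem ustar_add (x y : lp (fun _ : ℕ => ℝ) 1) : ustar (x + y) = ustar x + ustar y :=
  ((hasSum_ustar x).add (hasSum_ustar y)).tsum_eq

theorem ustar_smul (c : ℝ) (x : lp (fun _ : ℕ => ℝ) 1) : ustar (c • x) = c * ustar x :=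
  ((hasSum_ustar x).mul_left c).tsum_eq

theorem ustar_sum {κ : Type*} (s : Finset κ) (x : κ → lp (fun _ : ℕ => ℝ) 1) :
    ustar (∑ j ∈ s, x j) = ∑ j ∈ s, ustar (x j) := by
  classical
  induction s using Finset.induction_on with
  | empty => simp [ustar]
  | insert a s ha ih => rw [Finset.sum_insert ha, Finset.sum_insert ha, ustar_add, ih]

theorem norm_eq_ustar_of_nonneg {x : lp (fun _ : ℕ => ℝ) 1} (hx : ∀ k, 0 ≤ x k) :
    ‖x‖ = ustar x := by
  rw [norm_lp_one_eq_tsum, ustar]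
  exact tsum_congr fun k => abs_of_nonneg (hx k)

theorem ustar_le_norm (x : lp (fun _ : ℕ => ℝ) 1) : ustar x ≤ ‖x‖ := by
  rw [norm_lp_one_eq_tsum]
  exact (hasSum_ustar x).summable.tsum_le_tsum (fun k => le_abs_self _) (summable_abs_lp_one x)

theorem nonneg_of_norm_le_ustar {x : lp (fun _ : ℕ => ℝ) 1} (hx : ‖x‖ ≤ ustar x) (k : ℕ) :
    0 ≤ x k := by
  have h1 : HasSum (fun k => |x k| - x k) (‖x‖ - ustar x) := by
    rw [norm_lp_one_eq_tsum]
    exact (summable_abs_lp_one x).hasSum.sub (hasSum_ustar x)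
  have h2 : |x k| - x k ≤ ‖x‖ - ustar x :=
    le_hasSum h1 k fun j _ => sub_nonneg.2 (le_abs_self _)
  have h3 : |x k| ≤ x k := by linarith
  exact (abs_nonneg _).trans h3

/-- A nonnegative element of `ℓ₁` can be moved to any prescribed nonnegative mass at the least
possible cost. -/
theorem exists_nonneg_ustar_eq {x : lp (fun _ : ℕ => ℝ) 1} (hx : ∀ k, 0 ≤ x k) {L : ℝ}
    (hL : 0 ≤ L) : ∃ x' : lp (fun _ : ℕ => ℝ) 1, (∀ k, 0 ≤ x' k) ∧ ustar x' = L ∧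
      ‖x' - x‖ = |L - ustar x| := by
  rcases le_or_gt (ustar x) L with h | h
  · have he : ∀ k, 0 ≤ (lp.single (E := fun _ : ℕ => ℝ) 1 0 (L - ustar x)) k := by
      intro k
      by_cases hk : k = 0
      · subst hk; simpa using h
      · simp [lp.single_apply, hk]
    have hn : ‖lp.single (E := fun _ : ℕ => ℝ) 1 0 (L - ustar x)‖ = |L - ustar x| := by
      rw [lp.norm_single (by norm_num), Real.norm_eq_abs]
    refine ⟨x + lp.single 1 0 (L - ustar x), fun k => add_nonneg (hx k) (he k), ?_, ?_⟩
    · rw [ustar_add, ← norm_eq_ustar_of_nonneg he, hn, abs_of_nonneg (sub_nonneg.2 h)]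
      ring
    · rw [add_sub_cancel_left, hn]
  · have hpos : 0 < ustar x := hL.trans_lt h
    refine ⟨(L / ustar x) • x, fun k => mul_nonneg (div_nonneg hL hpos.le) (hx k), ?_, ?_⟩
    · rw [ustar_smul, div_mul_cancel₀ _ hpos.ne']
    · have : (L / ustar x) • x - x = (L / ustar x - 1) • x := by rw [sub_smul, one_smul]
      rw [this, norm_smul, norm_eq_ustar_of_nonneg hx, Real.norm_eq_abs]
      nth_rewrite 2 [← abs_of_pos hpos]
      rw [← abs_mul, sub_mul, div_mul_cancel₀ _ hpos.ne', one_mul]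

/-- The index set of the constraints defining `MSet`: increasing tuples of odd length. -/
abbrev OddTuple (n : ℕ) : Type :=
  {p : Σ k : Fin (n + 1), (Fin (k : ℕ) → Fin n) // Odd (p.1 : ℕ) ∧ StrictMono p.2}

/-- The alternating sum of a family along an increasing tuple of odd length. -/
def altSum {n : ℕ} {Y : Type*} [AddCommGroup Y] [Module ℝ Y] (p : OddTuple n) :
    (Fin n → Y) →ₗ[ℝ] Y :=
  ∑ j : Fin (p.1.1 : ℕ), ((-1 : ℝ) ^ (j : ℕ)) • LinearMap.proj (p.1.2 j)

theorem altSum_apply {n : ℕ} {Y : Type*} [AddCommGroup Y] [Module ℝ Y] (p : OddTuple n)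
    (y : Fin n → Y) : altSum p y = ∑ j : Fin (p.1.1 : ℕ), ((-1 : ℝ) ^ (j : ℕ)) • y (p.1.2 j) := by
  simp [altSum]

theorem mem_MSet_iff {n : ℕ} {Y : Type*} [NormedAddCommGroup Y] [NormedSpace ℝ Y]
    {y : Fin n → Y} : y ∈ MSet Y n ↔ ∀ p : OddTuple n, ‖altSum p y‖ ≤ 1 := by
  constructor
  · intro hy p
    rw [altSum_apply]
    exact hy p.1.1 p.2.1 (Nat.lt_succ_iff.1 p.1.1.2) p.1.2 p.2.2
  · intro hy k hk hkn c hc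
    have := hy ⟨⟨⟨k, Nat.lt_succ_iff.2 hkn⟩, c⟩, hk, hc⟩
    rwa [altSum_apply] at this

theorem exists_altSum_eq_apply {n : ℕ} (i : Fin n) : ∃ p : OddTuple n,
    ∀ (Y : Type) [AddCommGroup Y] [Module ℝ Y] (y : Fin n → Y), altSum p y = y i := by
  refine ⟨⟨⟨⟨1, by have := i.pos; omega⟩, fun _ => i⟩, odd_one, Subsingleton.strictMono _⟩, ?_⟩
  intro Y _ _ y
  rw [altSum_apply]
  exact (Fin.sum_univ_one _).trans (by simp)

theorem altSum_coord {n : ℕ} (p : OddTuple n) (y : Fin n → lp (fun _ : ℕ => ℝ) 1) (k : ℕ) :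
    altSum p y k = altSum p (fun i => y i k) := by
  simp only [altSum_apply]
  rw [lp.coeFn_sum, Finset.sum_apply]
  rfl

theorem altSum_sum_smul {n : ℕ} {κ Y : Type*} [Fintype κ] [AddCommGroup Y] [Module ℝ Y]
    (p : OddTuple n) (r : κ → Fin n → ℝ) (G : κ → Y) :
    altSum p (fun i => ∑ j, r j i • G j) = ∑ j, altSum p (r j) • G j := by
  simp only [altSum_apply, Finset.smul_sum, Finset.sum_smul, smul_smul, smul_eq_mul]
  exact Finset.sum_comm

theorem eventually_exists_near_mem_MSet (n : ℕ) {ε : ℝ} (hε : 0 < ε) (A : Set (Fin n)) :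
    ∀ᶠ ρ : ℝ in nhds 0, ∀ y ∈ MSet (lp (fun _ : ℕ => ℝ) 1) n,
      (∀ i ∈ A, 1 - ρ < ustar (y i)) →
        ∃ z ∈ MSet (lp (fun _ : ℕ => ℝ) 1) n, (∀ i, ‖z i - y i‖ < ε) ∧
          ∀ i ∈ A, (∀ k, 0 ≤ z i k) ∧ ustar (z i) = 1 := by
  have hf : Function.Injective
      (LinearMap.pi (fun p : OddTuple n => altSum (Y := ℝ) p)) := by
    intro a b hab
    funext i
    obtain ⟨p, hp⟩ := exists_altSum_eq_apply i
    rw [← hp ℝ a, ← hp ℝ b]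
    exact congrFun hab p
  obtain ⟨κ, _, r, hr, hdec⟩ := exists_conformal_generators _ hf
  simp only [LinearMap.pi_apply] at hdec
  have hr' : ∀ j, ∃ p : OddTuple n, 0 < |altSum p (r j)| := by
    intro j
    by_contra! hcon
    refine hr j (hf ?_)
    rw [map_zero]
    funext p
    exact abs_nonpos_iff.1 (hcon p)
  let K : Set (κ → ℝ) :=
    {L | (∀ j, 0 ≤ L j) ∧ ∀ p : OddTuple n, ∑ j, L j * |altSum p (r j)| ≤ 1}
  have hKcl : IsClosed K := by
    simp only [K, Set.ofPred_and, Set.ofPred_forall]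
    refine IsClosed.inter (isClosed_iInter fun j => isClosed_le (by fun_prop) (by fun_prop))
      (isClosed_iInter fun p => isClosed_le (by fun_prop) (by fun_prop))
  have hK : IsCompact K := by
    choose p hp using hr'
    refine (isCompact_univ_pi
      (fun j => isCompact_Icc (a := (0 : ℝ)) (b := 1 / |altSum (p j) (r j)|))).of_isClosed_subset
      hKcl ?_
    rintro L ⟨hL0, hL⟩ j -
    refine ⟨hL0 j, ?_⟩
    rw [le_div_iff₀ (hp j)]
    exact (Finset.single_le_sum (f := fun j' => L j' * |altSum (p j) (r j')|)
      (fun j' _ => mul_nonneg (hL0 j') (abs_nonneg _)) (Finset.mem_univ j)).trans (hL (p j))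
  let U : Set (κ → ℝ) := ⋃ L' ∈ {L' ∈ K | ∀ i : A, 1 ≤ ∑ j, r j i * L' j},
    ⋂ i : Fin n, {L | ∑ j, |r j i| * |L' j - L j| < ε}
  have hU : IsOpen U := by
    refine isOpen_biUnion fun L' _ => isOpen_iInter_of_finite fun i => ?_
    exact isOpen_lt (by fun_prop) (by fun_prop)
  have hsol : ∀ L ∈ K, (∀ i : A, 1 ≤ ∑ j, r j i * L j) → L ∈ U := by
    intro L hL hLi
    simp only [U, Set.mem_iUnion, Set.mem_iInter]
    exact ⟨L, ⟨hL, hLi⟩, fun i => by simpa using hε⟩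
  filter_upwards [hK.eventually_mem_of_almost_ge hU
    (h := fun (i : A) L => ∑ j, r j i * L j) (fun i => by fun_prop) hsol] with ρ hρ y hy hyA
  choose l hl0 hl hlabs using fun k : ℕ => hdec (fun i => y i k)
  have hsum : ∀ j, Summable fun k => |l k j| := by
    intro j
    obtain ⟨p, hp⟩ := hr' j
    have h1 : Summable fun k => |l k j| * |altSum p (r j)| := by
      refine Summable.of_nonneg_of_le (fun k => by positivity) (fun k => ?_)
        (summable_abs_lp_one (altSum p y))
      rw [altSum_coord, hlabs k p, abs_of_nonneg (hl0 k j)]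
      exact Finset.single_le_sum (f := fun j' => l k j' * |altSum p (r j')|)
        (fun j' _ => mul_nonneg (hl0 k j') (abs_nonneg _)) (Finset.mem_univ j)
    exact (summable_mul_right_iff hp.ne').1 h1
  let G : κ → lp (fun _ : ℕ => ℝ) 1 := fun j =>
    ⟨fun k => l k j, memℓp_gen (by simpa using hsum j)⟩
  have hG0 : ∀ j k, 0 ≤ G j k := fun j k => hl0 k j
  have hyG : ∀ i, y i = ∑ j, r j i • G j := by
    intro i
    ext k
    have := congrFun (hl k) i
    rw [lp.coeFn_sum, Finset.sum_apply]
    rw [Finset.sum_apply] at this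
    rw [this]
    exact Finset.sum_congr rfl fun j _ => mul_comm _ _
  have hGK : (fun j => ustar (G j)) ∈ K := by
    refine ⟨fun j => tsum_nonneg (hG0 j), fun p => ?_⟩
    refine le_of_eq_of_le ?_ (mem_MSet_iff.1 hy p)
    rw [norm_lp_one_eq_tsum]
    have h1 : HasSum (fun k => ∑ j, G j k * |altSum p (r j)|)
        (∑ j, ustar (G j) * |altSum p (r j)|) :=
      hasSum_sum fun j _ => (hasSum_ustar (G j)).mul_right _
    rw [← h1.tsum_eq]
    refine tsum_congr fun k => ?_
    rw [altSum_coord, hlabs k p]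
  have hus : ∀ (H : κ → lp (fun _ : ℕ => ℝ) 1) (i : Fin n),
      ustar (∑ j, r j i • H j) = ∑ j, r j i * ustar (H j) := by
    intro H i
    rw [ustar_sum]
    exact Finset.sum_congr rfl fun j _ => ustar_smul _ _
  have hmem := hρ _ hGK (fun i => by rw [← hus, ← hyG]; exact hyA i i.2)
  simp only [U, Set.mem_iUnion, Set.mem_iInter] at hmem
  obtain ⟨L', ⟨⟨hL0, hLK⟩, hL1⟩, hLε⟩ := hmem
  choose G' hG'0 hG'u hG'd using fun j => exists_nonneg_ustar_eq (hG0 j) (hL0 j)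
  have hz : (fun i => ∑ j, r j i • G' j) ∈ MSet (lp (fun _ : ℕ => ℝ) 1) n := by
    refine mem_MSet_iff.2 fun p => ?_
    rw [altSum_sum_smul]
    refine (norm_sum_le _ _).trans (le_of_eq_of_le ?_ (hLK p))
    refine Finset.sum_congr rfl fun j _ => ?_
    rw [norm_smul, norm_eq_ustar_of_nonneg (hG'0 j), hG'u, Real.norm_eq_abs, mul_comm]
  refine ⟨_, hz, fun i => ?_, fun i hi => ?_⟩
  · refine lt_of_le_of_lt ?_ (hLε i)
    rw [hyG i, ← Finset.sum_sub_distrib]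
    refine (norm_sum_le _ _).trans (le_of_eq ?_)
    refine Finset.sum_congr rfl fun j _ => ?_
    rw [← smul_sub, norm_smul, hG'd, Real.norm_eq_abs]
  · have hn : ‖∑ j, r j i • G' j‖ ≤ 1 := by
      obtain ⟨p, hp⟩ := exists_altSum_eq_apply i
      have := mem_MSet_iff.1 hz p
      rwa [hp] at this
    have h1 : 1 ≤ ustar (∑ j, r j i • G' j) := by
      rw [hus]
      simpa only [hG'u] using hL1 ⟨i, hi⟩
    exact ⟨nonneg_of_norm_le_ustar (hn.trans h1), le_antisymm ((ustar_le_norm _).trans hn) h1⟩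

/-- Theorem 4.2: for each `n` there is `ρₙ : (0,1) → (0,1)` with `ρₙ(ε) < ε`
such that for each `(y₁,…,yₙ) ∈ M_{ℓ₁}ⁿ` and `n₀ ≤ n` with `u*(yᵢ) > 1 − ρₙ(ε)` for all
`i ≤ n₀`, there is `(z₁,…,zₙ) ∈ M_{ℓ₁}ⁿ` with `‖zᵢ − yᵢ‖ < ε` for all `i ≤ n`, and `zᵢ ≥ 0`
with `u*(zᵢ) = 1` for all `i ≤ n₀` (0-indexed: `i ≤ n₀` becomes `(i : ℕ) < n₀`). -/
theorem stmt17 (n : ℕ) (hn : 0 < n) :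
    ∃ ρ : ℝ → ℝ, (∀ ε : ℝ, 0 < ε → ε < 1 → 0 < ρ ε ∧ ρ ε < ε) ∧
      ∀ ε : ℝ, 0 < ε → ε < 1 →
        ∀ y ∈ MSet (lp (fun _ : ℕ => ℝ) 1) n, ∀ n₀ : ℕ, n₀ ≤ n →
          (∀ i : Fin n, (i : ℕ) < n₀ → 1 - ρ ε < ustar (y i)) →
          ∃ z ∈ MSet (lp (fun _ : ℕ => ℝ) 1) n,
            (∀ i, ‖z i - y i‖ < ε) ∧
            ∀ i : Fin n, (i : ℕ) < n₀ → (∀ k, 0 ≤ z i k) ∧ ustar (z i) = 1 := by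
  have key : ∀ ε : ℝ, ∃ ρ : ℝ, 0 < ε → (0 < ρ ∧ ρ < ε) ∧
      ∀ m : Fin (n + 1), ∀ y ∈ MSet (lp (fun _ : ℕ => ℝ) 1) n,
        (∀ i ∈ {i : Fin n | (i : ℕ) < m}, 1 - ρ < ustar (y i)) →
          ∃ z ∈ MSet (lp (fun _ : ℕ => ℝ) 1) n, (∀ i, ‖z i - y i‖ < ε) ∧
            ∀ i ∈ {i : Fin n | (i : ℕ) < m}, (∀ k, 0 ≤ z i k) ∧ ustar (z i) = 1 := by
    intro ε
    by_cases hε : 0 < ε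
    · have h1 := Filter.eventually_all.2 fun m : Fin (n + 1) =>
        eventually_exists_near_mem_MSet n hε {i : Fin n | (i : ℕ) < m}
      obtain ⟨ρ, hρ, hρε⟩ := ((h1.filter_mono (nhdsWithin_le_nhds (s := Set.Ioi 0))).and
        (Ioo_mem_nhdsGT hε)).exists
      exact ⟨ρ, fun _ => ⟨hρε, hρ⟩⟩
    · exact ⟨0, fun h => absurd h hε⟩
  choose ρ hρ using key
  refine ⟨ρ, fun ε h0 _ => (hρ ε h0).1, fun ε h0 _ y hy n₀ hn₀ hyn => ?_⟩
  exact (hρ ε h0).2 ⟨n₀, Nat.lt_succ_iff.2 hn₀⟩ y hy hyn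
end
end

section
/- For each positive integer n there exists a function γₙ : (0,1) → (0,1) such that the space ℓ₁ has the approximate hyperplane sum property for ℓ∞ⁿ with the function γₙ, and for every positive integer m the space ℓ₁ᵐ (ℝᵐ with the ℓ₁-norm) has the approximate hyperplane sum property for ℓ∞ⁿ with the same function γₙ. -/
open scoped BigOperators

noncomputable section

theorem MSet.norm_le_one {Y : Type*} [NormedAddCommGroup Y] [NormedSpace ℝ Y] {n : ℕ}
    {y : Fin n → Y} (hy : y ∈ MSet Y n) (i : Fin n) : ‖y i‖ ≤ 1 := by
  simpa using hy 1 odd_one i.pos (fun _ => i) (Subsingleton.strictMono _)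

theorem MSet.norm_sum_le_card {Y : Type*} [NormedAddCommGroup Y] [NormedSpace ℝ Y] {n : ℕ}
    {y : Fin n → Y} (hy : y ∈ MSet Y n) (A : Finset (Fin n)) :
    ‖∑ i ∈ A, y i‖ ≤ (A.card : ℝ) := by
  simpa using norm_sum_le_of_le A fun i _ => MSet.norm_le_one hy i

theorem MSet.map {X Y : Type*} [NormedAddCommGroup X] [NormedSpace ℝ X]
    [NormedAddCommGroup Y] [NormedSpace ℝ Y] {n : ℕ} {y : Fin n → X} (hy : y ∈ MSet X n)
    (P : X →ₗ[ℝ] Y) (hP : ∀ v, ‖P v‖ ≤ ‖v‖) : (fun i => P (y i)) ∈ MSet Y n := by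
  intro k hk hkn c hc
  have h : ∑ j : Fin k, ((-1 : ℝ) ^ (j : ℕ)) • P (y (c j))
      = P (∑ j : Fin k, ((-1 : ℝ) ^ (j : ℕ)) • y (c j)) := by
    simp only [map_sum, map_smul]
  rw [h]
  exact (hP _).trans (hy k hk hkn c hc)

theorem isCompact_MSet (Y : Type*) [NormedAddCommGroup Y] [NormedSpace ℝ Y]
    [FiniteDimensional ℝ Y] (n : ℕ) : IsCompact (MSet Y n) := by
  have : ProperSpace Y := FiniteDimensional.proper ℝ Y
  refine Metric.isCompact_of_isClosed_isBounded ?_ ?_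
  · simp only [MSet, Set.ofPred_forall]
    refine isClosed_iInter fun k => isClosed_iInter fun _ => isClosed_iInter fun _ =>
      isClosed_iInter fun c => isClosed_iInter fun _ => ?_
    exact isClosed_le (by fun_prop) continuous_const
  · refine (Metric.isBounded_closedBall (x := (0 : Fin n → Y)) (r := 1)).subset fun y hy => ?_
    rw [mem_closedBall_zero_iff, pi_norm_le_iff_of_nonneg zero_le_one]
    exact MSet.norm_le_one hy

theorem exists_near_norm_sum_eq_card_of_finiteDimensional (Y : Type*) [NormedAddCommGroup Y]
    [NormedSpace ℝ Y] [FiniteDimensional ℝ Y] (n : ℕ) {ε : ℝ} (hε : 0 < ε) :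
    ∃ γ > 0, ∀ y ∈ MSet Y n, ∀ A : Finset (Fin n), (A.card : ℝ) - γ < ‖∑ i ∈ A, y i‖ →
      ∃ z ∈ MSet Y n, (∀ i, ‖z i - y i‖ < ε) ∧ ‖∑ i ∈ A, z i‖ = (A.card : ℝ) := by
  have key : ∀ A : Finset (Fin n), ∃ γ > 0, ∀ y ∈ MSet Y n,
      (A.card : ℝ) - γ < ‖∑ i ∈ A, y i‖ →
      ∃ z ∈ MSet Y n, dist y z < ε ∧ ‖∑ i ∈ A, z i‖ = (A.card : ℝ) := by
    intro A
    let U : Set (Fin n → Y) :=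
      ⋃ z ∈ {z | z ∈ MSet Y n ∧ ‖∑ i ∈ A, z i‖ = (A.card : ℝ)}, Metric.ball z ε
    have hU : IsOpen U := isOpen_biUnion fun _ _ => Metric.isOpen_ball
    have hmem : ∀ y ∈ U, ∃ z ∈ MSet Y n, dist y z < ε ∧ ‖∑ i ∈ A, z i‖ = (A.card : ℝ) := by
      intro y hy
      obtain ⟨z, ⟨hz, hz'⟩, hyz⟩ := Set.mem_iUnion₂.1 hy
      exact ⟨z, hz, hyz, hz'⟩
    rcases (MSet Y n \ U).eq_empty_or_nonempty with he | hne
    · exact ⟨1, one_pos, fun y hy _ => hmem y (Set.sdiff_eq_empty.1 he hy)⟩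
    · obtain ⟨y₀, hy₀, hmin⟩ := ((isCompact_MSet Y n).diff hU).exists_isMinOn hne
        (f := fun y => (A.card : ℝ) - ‖∑ i ∈ A, y i‖) (by fun_prop)
      refine ⟨(A.card : ℝ) - ‖∑ i ∈ A, y₀ i‖, ?_, fun y hy hyA => hmem y ?_⟩
      · refine sub_pos.2 ((MSet.norm_sum_le_card hy₀.1 A).lt_of_ne fun h => hy₀.2 ?_)
        exact Set.mem_biUnion (x := y₀) ⟨hy₀.1, h⟩ (Metric.mem_ball_self hε)
      · by_contra hyU
        have := isMinOn_iff.1 hmin y ⟨hy, hyU⟩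
        linarith
  choose γ hγ h using key
  obtain ⟨A₀, hA₀⟩ := Finite.exists_min γ
  refine ⟨γ A₀, hγ A₀, fun y hy A hA => ?_⟩
  obtain ⟨z, hz, hd, hz'⟩ := h A y hy (by linarith [hA₀ A])
  refine ⟨z, hz, fun i => ?_, hz'⟩
  rw [← dist_eq_norm, dist_comm]
  exact (dist_le_pi_dist y z i).trans_lt hd

theorem AHSpWith.of_linearIsometryEquiv {X Y : Type*} [NormedAddCommGroup X] [NormedSpace ℝ X]
    [NormedAddCommGroup Y] [NormedSpace ℝ Y] {n : ℕ} {γ : ℝ → ℝ} (h : AHSpWith X n γ)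
    (e : X ≃ₗᵢ[ℝ] Y) : AHSpWith Y n γ := by
  intro ε hε hε1
  obtain ⟨hγ, h⟩ := h ε hε hε1
  refine ⟨hγ, fun y hy A hA f hf hfy => ?_⟩
  obtain ⟨z, hz, hzy, hzA⟩ := h (fun i => e.symm (y i))
    (MSet.map hy e.symm.toLinearEquiv.toLinearMap fun v => (e.symm.norm_map v).le) A hA
    (f.comp (e : X →L[ℝ] Y)) (by
      rw [← hf]
      exact f.opNorm_comp_linearIsometryEquiv e) (by simpa using hfy)
  refine ⟨fun i => e (z i),
    MSet.map hz e.toLinearEquiv.toLinearMap fun v => (e.norm_map v).le, fun i => ?_, ?_⟩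
  · rw [← e.symm.norm_map, map_sub, e.symm_apply_apply]
    exact hzy i
  · rw [← map_sum, e.norm_map, hzA]

namespace lpOne

variable {ι : Type*}

theorem sub_apply (u v : lp (fun _ : ι => ℝ) 1) (k : ι) : (u - v) k = u k - v k := rfl

theorem smul_apply (c : ℝ) (v : lp (fun _ : ι => ℝ) 1) (k : ι) : (c • v) k = c * v k := rfl

theorem sum_apply {κ : Type*} (s : Finset κ) (v : κ → lp (fun _ : ι => ℝ) 1) (k : ι) :
    (∑ i ∈ s, v i) k = ∑ i ∈ s, v i k := by
  rw [lp.coeFn_sum]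
  exact Finset.sum_apply k s fun i => (v i : ι → ℝ)

theorem hasSum_norm (v : lp (fun _ : ι => ℝ) 1) : HasSum (fun k => |v k|) ‖v‖ := by
  simpa using lp.hasSum_norm (p := 1) (by simp) v

theorem memℓp {v : ι → ℝ} (hv : Summable fun k => |v k|) : Memℓp v 1 :=
  memℓp_gen (by simpa using hv)

theorem norm_le_mul_norm {u v : lp (fun _ : ι => ℝ) 1} {C : ℝ}
    (h : ∀ k, |u k| ≤ C * |v k|) : ‖u‖ ≤ C * ‖v‖ :=
  hasSum_le h (hasSum_norm u) ((hasSum_norm v).mul_left C)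

theorem norm_sum_smul_of_disjoint {κ : Type*} [Fintype κ] (e : κ → lp (fun _ : ι => ℝ) 1)
    (he : ∀ k i j, i ≠ j → e i k = 0 ∨ e j k = 0) (a : κ → ℝ) :
    ‖∑ i, a i • e i‖ = ∑ i, |a i| * ‖e i‖ := by
  have h : HasSum (fun k => ∑ i, |a i| * |e i k|) (∑ i, |a i| * ‖e i‖) :=
    hasSum_sum fun i _ => (hasSum_norm (e i)).mul_left _
  refine (hasSum_norm _).unique (h.congr_fun fun k => ?_)
  simp only [sum_apply, smul_apply]
  by_cases hk : ∃ i, e i k ≠ 0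
  · obtain ⟨i, hi⟩ := hk
    have h0 : ∀ j, j ≠ i → e j k = 0 := fun j hj => (he k j i hj).resolve_right hi
    rw [Finset.sum_eq_single i (fun j _ hj => by simp [h0 j hj]) (by simp),
      Finset.sum_eq_single i (fun j _ hj => by simp [h0 j hj]) (by simp), abs_mul]
  · push Not at hk
    simp [hk]

/-- The restriction of a summable family to a subset of the index set. -/
def restrict (s : Set ι) : lp (fun _ : ι => ℝ) 1 →ₗ[ℝ] lp (fun _ : ι => ℝ) 1 where
  toFun v := ⟨s.indicator v, memℓp (by
    refine (hasSum_norm v).summable.of_nonneg_of_le (fun _ => abs_nonneg _) fun k => ?_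
    by_cases hk : k ∈ s <;> simp [hk])⟩
  map_add' u v := lp.ext (Set.indicator_add s u v)
  map_smul' c v := lp.ext (Set.indicator_const_smul s c v)

theorem restrict_apply (s : Set ι) (v : lp (fun _ : ι => ℝ) 1) (k : ι) :
    restrict s v k = s.indicator v k := rfl

/-- The sum of a summable family, as a linear functional. -/
def total : lp (fun _ : ι => ℝ) 1 →ₗ[ℝ] ℝ where
  toFun v := ∑' k, v k
  map_add' u v := (hasSum_norm u).summable.of_abs.tsum_add (hasSum_norm v).summable.of_abs
  map_smul' _ _ := tsum_mul_left

theorem abs_total_le (v : lp (fun _ : ι => ℝ) 1) : |total v| ≤ ‖v‖ :=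
  tsum_of_norm_bounded (f := fun k => v k) (hasSum_norm v) fun _ => le_rfl

theorem abs_total_of_nonneg {v : lp (fun _ : ι => ℝ) 1} (hv : ∀ k, 0 ≤ v k) :
    |total v| = ‖v‖ := by
  have h : total v = ‖v‖ := by
    rw [← (hasSum_norm v).tsum_eq]
    exact tsum_congr fun k => (abs_of_nonneg (hv k)).symm
  rw [h, abs_of_nonneg (norm_nonneg v)]

theorem abs_total_of_nonpos {v : lp (fun _ : ι => ℝ) 1} (hv : ∀ k, v k ≤ 0) :
    |total v| = ‖v‖ := by
  have h := abs_total_of_nonneg (v := -v) fun k => neg_nonneg.2 (hv k)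
  simpa using h

section Blocks

variable {W : Type*} (b : ι → W)

theorem restrict_fiber_disjoint (v : lp (fun _ : ι => ℝ) 1) (k : ι) {w w' : W} (h : w ≠ w') :
    restrict (b ⁻¹' {w}) v k = 0 ∨ restrict (b ⁻¹' {w'}) v k = 0 := by
  by_cases hk : b k = w
  · exact Or.inr (by simp [restrict_apply, hk, h])
  · exact Or.inl (by simp [restrict_apply, hk])

theorem sum_norm_restrict_fiber [Fintype W] (v : lp (fun _ : ι => ℝ) 1) :
    ∑ w, ‖restrict (b ⁻¹' {w}) v‖ = ‖v‖ := by
  classical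
  have h := norm_sum_smul_of_disjoint (fun w => restrict (b ⁻¹' {w}) v)
    (fun k _ _ => restrict_fiber_disjoint b v k) (fun _ => 1)
  simp only [one_smul, abs_one, one_mul] at h
  rw [← h]
  congr 1
  ext k
  rw [sum_apply]
  simp [restrict_apply, Set.indicator_apply]

/-- Summation over the blocks indexed by `S`. -/
def blockSum (S : Finset W) : lp (fun _ : ι => ℝ) 1 →ₗ[ℝ] PiLp 1 (fun _ : S => ℝ) :=
  (WithLp.linearEquiv 1 ℝ (S → ℝ)).symm.toLinearMap ∘ₗ
    LinearMap.pi fun w => total ∘ₗ restrict (b ⁻¹' {(w : W)})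

theorem norm_blockSum_le [Fintype W] (S : Finset W) (v : lp (fun _ : ι => ℝ) 1) :
    ‖blockSum b S v‖ ≤ ‖v‖ := by
  rw [PiLp.norm_eq_of_L1, ← sum_norm_restrict_fiber b v]
  calc ∑ w : S, ‖blockSum b S v w‖
      ≤ ∑ w : S, ‖restrict (b ⁻¹' {(w : W)}) v‖ :=
        Finset.sum_le_sum fun w _ => abs_total_le _
    _ = ∑ w ∈ S, ‖restrict (b ⁻¹' {w}) v‖ :=
        Finset.sum_coe_sort S fun w => ‖restrict (b ⁻¹' {w}) v‖
    _ ≤ ∑ w, ‖restrict (b ⁻¹' {w}) v‖ :=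
        Finset.sum_le_univ_sum_of_nonneg fun _ => norm_nonneg _

theorem norm_blockSum_eq [Fintype W] {S : Finset W} {v : lp (fun _ : ι => ℝ) 1}
    (hS : ∀ w ∉ S, restrict (b ⁻¹' {w}) v = 0)
    (hv : ∀ k l, b k = b l → 0 ≤ v k → 0 ≤ v l) : ‖blockSum b S v‖ = ‖v‖ := by
  have habs : ∀ w, |total (restrict (b ⁻¹' {w}) v)| = ‖restrict (b ⁻¹' {w}) v‖ := by
    intro w
    by_cases h : ∃ k, b k = w ∧ 0 ≤ v k
    · obtain ⟨k, rfl, hk⟩ := h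
      exact abs_total_of_nonneg fun l => Set.indicator_apply_nonneg fun hl => hv k l hl.symm hk
    · push Not at h
      exact abs_total_of_nonpos fun l => Set.indicator_apply_nonpos fun hl => (h l hl).le
  rw [PiLp.norm_eq_of_L1, ← sum_norm_restrict_fiber b v]
  calc ∑ w : S, ‖blockSum b S v w‖
      = ∑ w : S, ‖restrict (b ⁻¹' {(w : W)}) v‖ := Finset.sum_congr rfl fun w _ => habs w
    _ = ∑ w ∈ S, ‖restrict (b ⁻¹' {w}) v‖ :=
        Finset.sum_coe_sort S fun w => ‖restrict (b ⁻¹' {w}) v‖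
    _ = ∑ w, ‖restrict (b ⁻¹' {w}) v‖ :=
        Finset.sum_subset (Finset.subset_univ S) fun w _ hw => by rw [hS w hw, norm_zero]

/-- The isometric embedding sending the basis vectors to the normalized restrictions of `r` to
its nonzero blocks. -/
def blockEmbedding {S : Finset W} {r : lp (fun _ : ι => ℝ) 1}
    (hS : ∀ w ∈ S, restrict (b ⁻¹' {w}) r ≠ 0) :
    PiLp 1 (fun _ : S => ℝ) →ₗᵢ[ℝ] lp (fun _ : ι => ℝ) 1 where
  toFun a := ∑ w : S, a w •
    (‖restrict (b ⁻¹' {(w : W)}) r‖⁻¹ • restrict (b ⁻¹' {(w : W)}) r)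
  map_add' a a' := by simp [add_smul, Finset.sum_add_distrib]
  map_smul' c a := by simp [Finset.smul_sum, mul_smul]
  norm_map' a := by
    have h := norm_sum_smul_of_disjoint
      (fun w : S => ‖restrict (b ⁻¹' {(w : W)}) r‖⁻¹ • restrict (b ⁻¹' {(w : W)}) r)
      (fun k w w' hww' =>
        (restrict_fiber_disjoint b r k (Subtype.coe_injective.ne hww')).imp
          (fun h => by simp [h]) fun h => by simp [h]) a
    refine h.trans ?_
    rw [PiLp.norm_eq_of_L1]
    refine Finset.sum_congr rfl fun w _ => ?_
    rw [norm_smul, norm_inv, norm_norm, inv_mul_cancel₀ (norm_ne_zero_iff.2 (hS w w.2)), mul_one,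
      Real.norm_eq_abs]

theorem norm_blockEmbedding_blockSum_sub_le {S : Finset W} {r x : lp (fun _ : ι => ℝ) 1}
    (hS : ∀ w, w ∈ S ↔ restrict (b ⁻¹' {w}) r ≠ 0) (hr : ∀ k, |x k| ≤ r k) {η : ℝ}
    (hη : ∀ k l, b k = b l → |r k * x l - x k * r l| ≤ η * r k * r l) :
    ‖blockEmbedding b (fun w => (hS w).1) (blockSum b S x) - x‖ ≤ η * ‖r‖ := by
  have hr0 : ∀ k, 0 ≤ r k := fun k => (abs_nonneg _).trans (hr k)
  refine norm_le_mul_norm fun k => ?_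
  have hcoord : blockEmbedding b (fun w => (hS w).1) (blockSum b S x) k
      = ∑ w : S, total (restrict (b ⁻¹' {(w : W)}) x) *
        (‖restrict (b ⁻¹' {(w : W)}) r‖⁻¹ * restrict (b ⁻¹' {(w : W)}) r k) := by
    exact sum_apply _ _ k
  rw [abs_of_nonneg (hr0 k), sub_apply, hcoord]
  by_cases hk : b k ∈ S
  · rw [Finset.sum_eq_single (⟨b k, hk⟩ : S)
      (fun w _ hw => by
        have : b k ≠ w := fun h => hw (Subtype.ext h.symm)
        simp [restrict_apply, this]) (by simp)]
    have hR : 0 < ‖restrict (b ⁻¹' {b k}) r‖ := norm_pos_iff.2 ((hS _).1 hk)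
    have hrk : restrict (b ⁻¹' {b k}) r k = r k := by simp [restrict_apply]
    have hle : |r k * total (restrict (b ⁻¹' {b k}) x) - x k * ‖restrict (b ⁻¹' {b k}) r‖|
        ≤ η * r k * ‖restrict (b ⁻¹' {b k}) r‖ := by
      have htot : total (restrict (b ⁻¹' {b k}) r) = ‖restrict (b ⁻¹' {b k}) r‖ := by
        rw [← (hasSum_norm _).tsum_eq]
        exact tsum_congr fun l => (abs_of_nonneg
          (Set.indicator_apply_nonneg fun _ => hr0 l)).symm
      have heq : r k * total (restrict (b ⁻¹' {b k}) x) - x k * ‖restrict (b ⁻¹' {b k}) r‖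
          = total (r k • restrict (b ⁻¹' {b k}) x - x k • restrict (b ⁻¹' {b k}) r) := by
        rw [← htot, map_sub, map_smul, map_smul, smul_eq_mul, smul_eq_mul]
      rw [heq]
      refine (abs_total_le _).trans (norm_le_mul_norm fun l => ?_)
      by_cases hl : b l = b k
      · simpa [sub_apply, smul_apply, restrict_apply, hl, abs_of_nonneg (hr0 l)] using hη k l hl.symm
      · simp [sub_apply, smul_apply, restrict_apply, hl]
    simp only [hrk]
    have heq : total (restrict (b ⁻¹' {b k}) x) * (‖restrict (b ⁻¹' {b k}) r‖⁻¹ * r k) - x k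
        = (r k * total (restrict (b ⁻¹' {b k}) x) - x k * ‖restrict (b ⁻¹' {b k}) r‖)
          / ‖restrict (b ⁻¹' {b k}) r‖ := by
      field_simp
    rw [heq, abs_div, abs_of_pos hR, div_le_iff₀ hR]
    exact hle
  · have hrk : r k = 0 := by
      have h0 : restrict (b ⁻¹' {b k}) r = 0 := not_not.1 fun h => hk ((hS _).2 h)
      have := congrArg (fun u : lp (fun _ : ι => ℝ) 1 => u k) h0
      simpa [restrict_apply] using this
    have hxk : x k = 0 := abs_nonpos_iff.1 (hrk ▸ hr k)
    rw [Finset.sum_eq_zero, hrk, hxk]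
    · simp
    · intro w _
      have : b k ≠ w := fun h => hk (h ▸ w.2)
      simp [restrict_apply, this]

end Blocks

/-- The integers in `[-N, N]`, recording one coordinate of a vector of the cube up to `1 / N`. -/
abbrev Grid (N : ℕ) : Type := Set.Icc (-(N : ℤ)) N

theorem exists_rounding {N : ℕ} (hN : 0 < N) :
    ∃ q : ℝ → ℝ → Grid N, ∀ s t s' t', |s| ≤ t → |s'| ≤ t' → q s t = q s' t' →
      (0 ≤ s → 0 ≤ s') ∧ |t * s' - s * t'| ≤ (N : ℝ)⁻¹ * t * t' := by
  have hN' : (0 : ℝ) < N := Nat.cast_pos.2 hN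
  have hquot : ∀ s t : ℝ, |s| ≤ t → s = t * (s / t) := by
    intro s t h
    rcases eq_or_ne t 0 with rfl | ht
    · simpa using h
    · field_simp
  have hmem : ∀ s t : ℝ, |s| ≤ t → ⌊N * (s / t)⌋ ∈ Set.Icc (-(N : ℤ)) N := by
    intro s t h
    have ht : 0 ≤ t := (abs_nonneg s).trans h
    have h1 : |s / t| ≤ 1 := by
      rw [abs_div, abs_of_nonneg ht]
      exact div_le_one_of_le₀ h ht
    obtain ⟨hl, hu⟩ := abs_le.1 h1
    refine ⟨Int.le_floor.2 ?_, Int.floor_le_iff.2 ?_⟩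
    · push_cast
      nlinarith
    · push_cast
      nlinarith
  refine ⟨fun s t => Set.projIcc (-(N : ℤ)) N (by lia) ⌊N * (s / t)⌋,
    fun s t s' t' hs hs' hq => ?_⟩
  have ht : 0 ≤ t := (abs_nonneg s).trans hs
  have ht' : 0 ≤ t' := (abs_nonneg s').trans hs'
  dsimp only at hq
  rw [Set.projIcc_of_mem _ (hmem s t hs), Set.projIcc_of_mem _ (hmem s' t' hs'),
    Subtype.mk.injEq] at hq
  constructor
  · intro h0
    have hf : 0 ≤ ⌊N * (s' / t')⌋ := hq ▸ Int.floor_nonneg.2 (by positivity)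
    rw [hquot s' t' hs']
    exact mul_nonneg ht' (nonneg_of_mul_nonneg_right (Int.floor_nonneg.1 hf) hN')
  · have hd := (Int.abs_sub_lt_one_of_floor_eq_floor hq).le
    have heq : t * s' - s * t' = -((N : ℝ)⁻¹ * t * t' * (N * (s / t) - N * (s' / t'))) := by
      linear_combination t * hquot s' t' hs' - t' * hquot s t hs
        + t * t' * (s / t - s' / t') * inv_mul_cancel₀ hN'.ne'
    rw [heq, abs_neg, abs_mul, abs_of_nonneg (by positivity)]
    exact mul_le_of_le_one_right (by positivity) hd

theorem exists_finite_block_approximation {κ : Type*} [Fintype κ] {N : ℕ} (hN : 0 < N)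
    (x : κ → lp (fun _ : ι => ℝ) 1) :
    ∃ (S : Finset (κ → Grid N))
      (P : lp (fun _ : ι => ℝ) 1 →ₗ[ℝ] PiLp 1 (fun _ : S => ℝ))
      (J : PiLp 1 (fun _ : S => ℝ) →ₗᵢ[ℝ] lp (fun _ : ι => ℝ) 1),
      (∀ v, ‖P v‖ ≤ ‖v‖) ∧
        ∀ i, ‖P (x i)‖ = ‖x i‖ ∧ ‖J (P (x i)) - x i‖ ≤ (N : ℝ)⁻¹ * ∑ j, ‖x j‖ := by
  classical
  obtain ⟨q, hq⟩ := exists_rounding hN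
  have hsum : HasSum (fun k => abs (∑ j, |x j k|)) (∑ j, ‖x j‖) :=
    (hasSum_sum fun j _ => hasSum_norm (x j)).congr_fun fun k =>
      abs_of_nonneg (Finset.sum_nonneg fun j _ => abs_nonneg (x j k))
  let r : lp (fun _ : ι => ℝ) 1 := ⟨fun k => ∑ j, |x j k|, memℓp hsum.summable⟩
  have hr : ‖r‖ = ∑ j, ‖x j‖ := (hasSum_norm r).unique hsum
  have hxr : ∀ j k, |x j k| ≤ r k := fun j k =>
    Finset.single_le_sum (f := fun j => |x j k|) (fun _ _ => abs_nonneg _) (Finset.mem_univ j)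
  let b : ι → κ → Grid N := fun k j => q (x j k) (r k)
  let S : Finset (κ → Grid N) := Finset.univ.filter fun w => restrict (b ⁻¹' {w}) r ≠ 0
  have hS : ∀ w, w ∈ S ↔ restrict (b ⁻¹' {w}) r ≠ 0 := by simp [S]
  have hb : ∀ j k l, b k = b l → _ := fun j k l h =>
    hq (x j k) (r k) (x j l) (r l) (hxr j k) (hxr j l) (congrFun h j)
  refine ⟨S, blockSum b S, blockEmbedding b fun w => (hS w).1, norm_blockSum_le b S,
    fun j => ⟨norm_blockSum_eq b (fun w hw => ?_) fun k l h => (hb j k l h).1, ?_⟩⟩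
  · have h0 : restrict (b ⁻¹' {w}) r = 0 := not_not.1 fun h => hw ((hS w).2 h)
    have hle : ‖restrict (b ⁻¹' {w}) (x j)‖ ≤ 1 * ‖restrict (b ⁻¹' {w}) r‖ := by
      refine norm_le_mul_norm fun k => ?_
      by_cases hk : b k = w
      · simpa [restrict_apply, hk] using (hxr j k).trans (le_abs_self _)
      · simp [restrict_apply, hk]
    rw [h0, norm_zero, mul_zero] at hle
    exact norm_le_zero_iff.1 hle
  · rw [← hr]
    exact norm_blockEmbedding_blockSum_sub_le b hS (hxr j) fun k l h => (hb j k l h).2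

end lpOne

theorem exists_near_norm_sum_eq_card_lp_one (n : ℕ) {ε : ℝ} (hε : 0 < ε) :
    ∃ γ > 0, ∀ (ι : Type) (y : Fin n → lp (fun _ : ι => ℝ) 1), y ∈ MSet _ n →
      ∀ A : Finset (Fin n), (A.card : ℝ) - γ < ‖∑ i ∈ A, y i‖ →
        ∃ z ∈ MSet (lp (fun _ : ι => ℝ) 1) n,
          (∀ i, ‖z i - y i‖ < ε) ∧ ‖∑ i ∈ A, z i‖ = (A.card : ℝ) := by
  obtain ⟨N, hN⟩ := exists_nat_gt (2 * n / (ε / 2))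
  have hN' : (0 : ℝ) < N := lt_of_le_of_lt (by positivity) hN
  choose γ hγ h using fun S : Finset (Option (Fin n) → lpOne.Grid N) =>
    exists_near_norm_sum_eq_card_of_finiteDimensional (PiLp 1 (fun _ : S => ℝ)) n (half_pos hε)
  obtain ⟨S₀, hS₀⟩ := Finite.exists_min γ
  refine ⟨γ S₀, hγ S₀, fun ι y hy A hA => ?_⟩
  let x : Option (Fin n) → lp (fun _ : ι => ℝ) 1 := fun j => j.elim (∑ i ∈ A, y i) y
  have hx : ∑ j, ‖x j‖ ≤ 2 * n := by
    have h1 : ‖∑ i ∈ A, y i‖ ≤ n := (MSet.norm_sum_le_card hy A).trans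
      (by exact_mod_cast (Finset.card_le_univ A).trans_eq (Fintype.card_fin n))
    have h2 : ∑ i, ‖y i‖ ≤ n := by
      simpa using Finset.sum_le_sum fun i (_ : i ∈ Finset.univ) => MSet.norm_le_one hy i
    rw [Fintype.sum_option]
    simp only [x, Option.elim_none, Option.elim_some]
    linarith
  obtain ⟨S, P, J, hP, hPJ⟩ := lpOne.exists_finite_block_approximation (Nat.cast_pos.1 hN') x
  have hPA : ‖∑ i ∈ A, P (y i)‖ = ‖∑ i ∈ A, y i‖ := by
    rw [← map_sum]
    exact (hPJ none).1
  obtain ⟨z, hz, hzy, hzA⟩ := h S _ (MSet.map hy P hP) A (by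
    rw [hPA]
    linarith [hS₀ S])
  refine ⟨fun i => J (z i), MSet.map hz J.toLinearMap fun v => (J.norm_map v).le, fun i => ?_, ?_⟩
  · have h1 : ‖J (z i) - J (P (y i))‖ < ε / 2 := by
      rw [← map_sub, J.norm_map]
      exact hzy i
    have h2 : ‖J (P (y i)) - y i‖ ≤ ε / 2 := by
      refine (hPJ (some i)).2.trans ?_
      rw [div_lt_iff₀ (half_pos hε)] at hN
      rw [inv_mul_le_iff₀ hN']
      exact hx.trans hN.le
    calc ‖J (z i) - y i‖ ≤ ‖J (z i) - J (P (y i))‖ + ‖J (P (y i)) - y i‖ :=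
          norm_sub_le_norm_sub_add_norm_sub _ _ _
      _ < ε := by linarith
  · rw [← map_sum, J.norm_map, hzA]

theorem exists_AHSpWith_lp_one (n : ℕ) (hn : 0 < n) :
    ∃ γ : ℝ → ℝ, ∀ ι : Type, AHSpWith (lp (fun _ : ι => ℝ) 1) n γ := by
  have hn' : (0 : ℝ) < n := Nat.cast_pos.2 hn
  have key : ∀ ε : ℝ, ∃ γ : ℝ, 0 < ε → (0 < γ ∧ γ < ε) ∧ ∀ (ι : Type)
      (y : Fin n → lp (fun _ : ι => ℝ) 1), y ∈ MSet _ n →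
      ∀ A : Finset (Fin n), (A.card : ℝ) - n * γ < ‖∑ i ∈ A, y i‖ →
        ∃ z ∈ MSet (lp (fun _ : ι => ℝ) 1) n,
          (∀ i, ‖z i - y i‖ < ε) ∧ ‖∑ i ∈ A, z i‖ = (A.card : ℝ) := by
    intro ε
    by_cases hε : 0 < ε
    · obtain ⟨γ, hγ, h⟩ := exists_near_norm_sum_eq_card_lp_one n hε
      refine ⟨min (γ / n) (ε / 2), fun _ => ⟨⟨by positivity, ?_⟩, fun ι y hy A hA => ?_⟩⟩
      · exact (min_le_right _ _).trans_lt (half_lt_self hε)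
      · refine h ι y hy A (lt_of_le_of_lt ?_ hA)
        have := (le_div_iff₀' hn').1 (min_le_left (γ / n) (ε / 2))
        linarith
    · exact ⟨0, fun h => absurd h hε⟩
  choose γ hγ using key
  refine ⟨γ, fun ι ε hε _ => ⟨(hγ ε hε).1, fun y hy A hA f hf hfA => ?_⟩⟩
  refine (hγ ε hε).2 ι y hy A ?_
  have hcard : (A.card : ℝ) ≤ n := by
    exact_mod_cast (Finset.card_le_univ A).trans_eq (Fintype.card_fin n)
  calc (A.card : ℝ) - n * γ ε ≤ A.card * (1 - γ ε) := by nlinarith [(hγ ε hε).1.1]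
    _ = ∑ _i ∈ A, (1 - γ ε) := by rw [Finset.sum_const, nsmul_eq_mul]
    _ < ∑ i ∈ A, f (y i) := Finset.sum_lt_sum_of_nonempty hA hfA
    _ = f (∑ i ∈ A, y i) := (map_sum f _ _).symm
    _ ≤ ‖f‖ * ‖∑ i ∈ A, y i‖ := (le_abs_self _).trans (f.le_opNorm _)
    _ = ‖∑ i ∈ A, y i‖ := by rw [hf, one_mul]

/-- Corollary 4.3: for each `n` there is one function `γₙ` such that `ℓ₁` has
the AHSp-ℓ∞ⁿ with function `γₙ` and, for every `m`, `ℓ₁ᵐ` has the AHSp-ℓ∞ⁿ with the same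
function `γₙ`. -/
theorem stmt18 (n : ℕ) (hn : 0 < n) :
    ∃ γ : ℝ → ℝ, AHSpWith (lp (fun _ : ℕ => ℝ) 1) n γ ∧
      ∀ m : ℕ, 0 < m → AHSpWith (PiLp 1 (fun _ : Fin m => ℝ)) n γ := by
  obtain ⟨γ, hγ⟩ := exists_AHSpWith_lp_one n hn
  exact ⟨γ, hγ ℕ, fun m _ => (hγ (Fin m)).of_linearIsometryEquiv (lpPiLpₗᵢ (fun _ => ℝ) ℝ)⟩
end
end
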